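/- Finite-time trajectory stability bound for the fast iterate (Theorem 1(i)). Suppose the projected two-timescale SA iterates (λ_t, ξ_t) are driven by a Markov process with kernel 𝒦 started at w ∈ 𝒲, that (𝒦, ν, c₁, ρ) satisfies the U_d-geometric-ergodicity bound for d = 1 and for d = 2, that Assumption 2 holds, and that 1/2 < κ ≤ δ < 1. Fix arbitrary C > 0, κ_c ∈ [0, κ − 1/2), and δ_c ∈ [0, δ − 1/2). Then there exist a constant C_λ > 0 (depending on δ, δ_c, κ, κ_c, C, and w) and an integer T₀ such that for every integer T ≥ T₀: P( ‖λ_t − λ*‖ ≤ C·t^{−κ_c} for all t ≥ T ) ≥ 1 − C_λ·T^{−(2κ−1−2κ_c)}·ln T. Moreover, if 𝒦(w') = ν for every w' ∈ 𝒲 (the i.i.d. case), the factor ln T can be removed from the bound. -/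

import Mathlib

open MeasureTheory ProbabilityTheory Filter
open scoped RealInnerProductSpace

noncomputable section

/-- Euclidean state space. -/
abbrev Wsp (dW : ℕ) : Type := EuclideanSpace ℝ (Fin dW)

/-- `t`-step iterate of a Markov kernel. -/
noncomputable def kiter {α : Type*} [MeasurableSpace α] (K : Kernel α α) : ℕ → Kernel α α :=
  fun t => Nat.rec (motive := fun _ => Kernel α α) Kernel.id (fun _ ih => ih.comp K) t

instance kiter_isMarkovKernel {α : Type*} [MeasurableSpace α] (K : Kernel α α)
    [IsMarkovKernel K] (t : ℕ) : IsMarkovKernel (kiter K t) := by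
  induction t with
  | zero => exact inferInstanceAs (IsMarkovKernel (Kernel.id))
  | succ n ih => exact inferInstanceAs (IsMarkovKernel ((kiter K n).comp K))

/-- U_d geometric ergodicity bound. -/
def UdBound {dW : ℕ} (K : Kernel (Wsp dW) (Wsp dW)) [IsMarkovKernel K]
    (ν : Measure (Wsp dW)) [IsProbabilityMeasure ν] (c₁ ρ d : ℝ) : Prop :=
  Integrable (fun w' => (1 : ℝ) + ‖w'‖ ^ d) ν ∧
  ∀ (t : ℕ) (w : Wsp dW) (f : Wsp dW → ℝ), Measurable f →
    (∀ w', |f w'| ≤ 1 + ‖w'‖ ^ d) →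
      (∫ w', |f w'|
          ∂((((kiter K t) w).toSignedMeasure - ν.toSignedMeasure).totalVariation))
        ≤ c₁ * ρ ^ t * (1 + ‖w‖ ^ d)

/-- Markov process with kernel `K` started at `w`. -/
structure IsMarkovProc {dW : ℕ} {Ω : Type*} [MeasurableSpace Ω]
    (K : Kernel (Wsp dW) (Wsp dW)) (P : Measure Ω)
    (Wp : ℕ → Ω → Wsp dW) (w : Wsp dW) : Prop where
  meas : ∀ t, Measurable (Wp t)
  init : ∀ᵐ ω ∂P, Wp 0 ω = w
  markov : ∀ (t : ℕ) (f : Wsp dW → ℝ), Measurable f → (∃ C, ∀ x, |f x| ≤ C) →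
    (P[(fun ω => f (Wp (t+1) ω)) |
        ⨆ s ∈ Finset.range (t+1), MeasurableSpace.comap (Wp s) inferInstance])
      =ᵐ[P] fun ω => ∫ x, f x ∂(K (Wp t ω))

/-- Metric projection onto the closed ball of radius `B` centered at the origin. -/
def projB {E : Type*} [NormedAddCommGroup E] [NormedSpace ℝ E] (B : ℝ) (x : E) : E :=
  if ‖x‖ ≤ B then x else (B / ‖x‖) • x

/-- The slow (first-stage) SA iterates. -/
def xiSeq {dW dX : ℕ} {Ω : Type*}
    (H : Wsp dW → EuclideanSpace ℝ (Fin dX) → EuclideanSpace ℝ (Fin dX))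
    (β : ℕ → ℝ) (B : ℝ) (Wp : ℕ → Ω → Wsp dW) (xi0 : EuclideanSpace ℝ (Fin dX)) :
    ℕ → Ω → EuclideanSpace ℝ (Fin dX) :=
  fun t => Nat.rec (motive := fun _ => Ω → EuclideanSpace ℝ (Fin dX)) (fun _ => xi0)
    (fun s ih => fun ω => projB B (ih ω + β s • H (Wp s ω) (ih ω))) t

/-- The fast SA iterates. -/
def lamSeq {dW dL dX : ℕ} {Ω : Type*}
    (G : Wsp dW → EuclideanSpace ℝ (Fin dL) → EuclideanSpace ℝ (Fin dX) →
      EuclideanSpace ℝ (Fin dL))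
    (H : Wsp dW → EuclideanSpace ℝ (Fin dX) → EuclideanSpace ℝ (Fin dX))
    (α β : ℕ → ℝ) (B : ℝ) (Wp : ℕ → Ω → Wsp dW)
    (lam0 : EuclideanSpace ℝ (Fin dL)) (xi0 : EuclideanSpace ℝ (Fin dX)) :
    ℕ → Ω → EuclideanSpace ℝ (Fin dL) :=
  fun t => Nat.rec (motive := fun _ => Ω → EuclideanSpace ℝ (Fin dL)) (fun _ => lam0)
    (fun s ih => fun ω =>
      projB B (ih ω + α s • G (Wp s ω) (ih ω) (xiSeq H β B Wp xi0 s ω))) t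

/-- Assumption 2. -/
structure Assumption2 {dW dL dX : ℕ}
    (ν : Measure (Wsp dW))
    (G : Wsp dW → EuclideanSpace ℝ (Fin dL) → EuclideanSpace ℝ (Fin dX) →
      EuclideanSpace ℝ (Fin dL))
    (H : Wsp dW → EuclideanSpace ℝ (Fin dX) → EuclideanSpace ℝ (Fin dX))
    (lamStar : EuclideanSpace ℝ (Fin dL)) (xiStar : EuclideanSpace ℝ (Fin dX))
    (B L ζ ψ : ℝ) : Prop where
  hGmeas : Measurable fun p : Wsp dW × EuclideanSpace ℝ (Fin dL) × EuclideanSpace ℝ (Fin dX) =>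
    G p.1 p.2.1 p.2.2
  hHmeas : Measurable fun p : Wsp dW × EuclideanSpace ℝ (Fin dX) => H p.1 p.2
  hHstar : (∫ w', H w' xiStar ∂ν) = 0
  hHuniq : ∀ ξ, (∫ w', H w' ξ ∂ν) = 0 → ξ = xiStar
  hGstar : (∫ w', G w' lamStar xiStar ∂ν) = 0
  hGuniq : ∀ lam, (∫ w', G w' lam xiStar ∂ν) = 0 → lam = lamStar
  hB : max ‖lamStar‖ ‖xiStar‖ < B
  hL : 0 < L
  hGLip : ∀ (w' : Wsp dW) lam lam' ξ ξ', ‖lam‖ ≤ B → ‖lam'‖ ≤ B → ‖ξ‖ ≤ B → ‖ξ'‖ ≤ B →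
    ‖G w' lam ξ - G w' lam' ξ'‖ ≤ L * (1 + ‖w'‖) * (‖lam - lam'‖ + ‖ξ - ξ'‖)
  hHLip : ∀ (w' : Wsp dW) ξ ξ', ‖ξ‖ ≤ B → ‖ξ'‖ ≤ B →
    ‖H w' ξ - H w' ξ'‖ ≤ L * (1 + ‖w'‖) * ‖ξ - ξ'‖
  hGgrow : ∀ (w' : Wsp dW) lam ξ, ‖lam‖ ≤ B → ‖ξ‖ ≤ B → ‖G w' lam ξ‖ ≤ L * (1 + ‖w'‖)
  hHgrow : ∀ (w' : Wsp dW) ξ, ‖ξ‖ ≤ B → ‖H w' ξ‖ ≤ L * (1 + ‖w'‖)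
  hζ : 0 < ζ
  hGmono : ∀ lam, ⟪lam - lamStar,
      (∫ w', G w' lam xiStar ∂ν) - (∫ w', G w' lamStar xiStar ∂ν)⟫
      ≤ -ζ * ‖lam - lamStar‖ ^ 2
  hψ : 0 < ψ
  hHmono : ∀ ξ, ⟪ξ - xiStar, (∫ w', H w' ξ ∂ν) - (∫ w', H w' xiStar ∂ν)⟫
      ≤ -ψ * ‖ξ - xiStar‖ ^ 2


section Iterates

variable {α : Type*} [MeasurableSpace α] (K : Kernel α α)

theorem kiter_zero_apply (w : α) : kiter K 0 w = Measure.dirac w := Kernel.id_apply w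

theorem kiter_succ (t : ℕ) : kiter K (t + 1) = (kiter K t).comp K := rfl

theorem kiter_one : kiter K 1 = K := Kernel.id_comp K

theorem kiter_succ' (t : ℕ) : kiter K (t + 1) = K.comp (kiter K t) := by
  induction t with
  | zero => exact (Kernel.id_comp K).trans (Kernel.comp_id K).symm
  | succ n ih => rw [kiter_succ, ih, Kernel.comp_assoc, ← kiter_succ, ih]

end Iterates

theorem abs_integral_sub_le_integral_totalVariation {α : Type*} [MeasurableSpace α]
    (μ ν : Measure α) [IsFiniteMeasure μ] [IsFiniteMeasure ν] {f : α → ℝ} (hf : Measurable f)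
    {b : ℝ} (hb : ∀ x, |f x| ≤ b) :
    |(∫ x, f x ∂μ) - ∫ x, f x ∂ν|
      ≤ ∫ x, |f x| ∂(μ.toSignedMeasure - ν.toSignedMeasure).totalVariation := by
  have hint : ∀ (m : Measure α) [IsFiniteMeasure m], Integrable f m := fun m _ =>
    Integrable.of_bound hf.aestronglyMeasurable b (ae_of_all _ hb)
  set s := μ.toSignedMeasure - ν.toSignedMeasure
  set p := s.toJordanDecomposition.posPart
  set n := s.toJordanDecomposition.negPart
  have hsum : μ + n = ν + p := by
    rw [← Measure.toSignedMeasure_eq_toSignedMeasure_iff, Measure.toSignedMeasure_add,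
      Measure.toSignedMeasure_add]
    have h : p.toSignedMeasure - n.toSignedMeasure = μ.toSignedMeasure - ν.toSignedMeasure :=
      s.toSignedMeasure_toJordanDecomposition
    rw [sub_eq_sub_iff_add_eq_add] at h
    rw [← h, add_comm]
  have hdiff : (∫ x, f x ∂μ) - ∫ x, f x ∂ν = (∫ x, f x ∂p) - ∫ x, f x ∂n := by
    have h := congrArg (fun m => ∫ x, f x ∂m) hsum
    simp only [integral_add_measure (hint _) (hint _)] at h
    linarith
  have htv : s.totalVariation = p + n := rfl
  rw [hdiff, htv, integral_add_measure (hint p).abs (hint n).abs]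
  exact (abs_sub _ _).trans
    (add_le_add (abs_integral_le_integral_abs) (abs_integral_le_integral_abs))

section Ergodic

variable {dW : ℕ} {K : Kernel (Wsp dW) (Wsp dW)} [IsMarkovKernel K]
  {ν : Measure (Wsp dW)} [IsProbabilityMeasure ν] {c₁ ρ d : ℝ}

theorem UdBound.abs_integral_sub_le_of_bounded (hU : UdBound K ν c₁ ρ d) (t : ℕ) (w : Wsp dW)
    {f : Wsp dW → ℝ} (hf : Measurable f) (hfd : ∀ w', |f w'| ≤ 1 + ‖w'‖ ^ d)
    {b : ℝ} (hb : ∀ x, |f x| ≤ b) :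
    |(∫ x, f x ∂(kiter K t w)) - ∫ x, f x ∂ν| ≤ c₁ * ρ ^ t * (1 + ‖w‖ ^ d) :=
  (abs_integral_sub_le_integral_totalVariation _ _ hf hb).trans (hU.2 t w f hf hfd)

theorem UdBound.integrable_kiter (hU : UdBound K ν c₁ ρ d) (t : ℕ) (w : Wsp dW) :
    Integrable (fun w' => (1 : ℝ) + ‖w'‖ ^ d) (kiter K t w) := by
  have hmeas : Measurable fun w' : Wsp dW => (1 : ℝ) + ‖w'‖ ^ d := by fun_prop
  have hpos : ∀ w' : Wsp dW, (0 : ℝ) ≤ 1 + ‖w'‖ ^ d := fun w' => by positivity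
  set M : ℝ := (∫ x, (1 + ‖x‖ ^ d) ∂ν) + c₁ * ρ ^ t * (1 + ‖w‖ ^ d)
  have hint : ∀ n : ℕ, Integrable (fun x : Wsp dW => min (1 + ‖x‖ ^ d) (n : ℝ))
      (kiter K t w) := fun n =>
    Integrable.of_bound (hmeas.min measurable_const).aestronglyMeasurable (n : ℝ)
      (ae_of_all _ fun x => by
        rw [Real.norm_eq_abs, abs_of_nonneg (le_min (hpos x) n.cast_nonneg)]
        exact min_le_right _ _)
  have hbd : ∀ n : ℕ, ∫ x, min (1 + ‖x‖ ^ d) (n : ℝ) ∂(kiter K t w) ≤ M := by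
    intro n
    have h0 : ∀ x : Wsp dW, 0 ≤ min (1 + ‖x‖ ^ d) (n : ℝ) := fun x =>
      le_min (hpos x) n.cast_nonneg
    have h1 := hU.abs_integral_sub_le_of_bounded t w
      (f := fun x => min (1 + ‖x‖ ^ d) (n : ℝ)) (hmeas.min measurable_const)
      (fun x => by rw [abs_of_nonneg (h0 x)]; exact min_le_left _ _) (b := n)
      (fun x => by rw [abs_of_nonneg (h0 x)]; exact min_le_right _ _)
    have h2 : ∫ x, min (1 + ‖x‖ ^ d) (n : ℝ) ∂ν ≤ ∫ x, (1 + ‖x‖ ^ d) ∂ν :=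
      integral_mono_of_nonneg (ae_of_all _ h0) hU.1 (ae_of_all _ fun x => min_le_left _ _)
    have := (abs_le.1 h1).2
    linarith
  refine ⟨hmeas.aestronglyMeasurable, ?_⟩
  rw [hasFiniteIntegral_iff_ofReal (ae_of_all _ hpos)]
  have hlim : ∫⁻ x, ENNReal.ofReal (1 + ‖x‖ ^ d) ∂(kiter K t w)
      ≤ liminf (fun n : ℕ => ∫⁻ x, ENNReal.ofReal (min (1 + ‖x‖ ^ d) (n : ℝ)) ∂(kiter K t w))
        atTop := by
    refine le_trans (lintegral_mono fun x => ?_) (lintegral_liminf_le fun n =>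
      (hmeas.min measurable_const).ennreal_ofReal)
    refine le_of_eq (Tendsto.liminf_eq ?_).symm
    refine tendsto_const_nhds.congr' ?_
    obtain ⟨n, hn⟩ := exists_nat_ge (1 + ‖x‖ ^ d)
    filter_upwards [eventually_ge_atTop n] with k hk
    rw [min_eq_left (hn.trans (by exact_mod_cast hk))]
  refine lt_of_le_of_lt (hlim.trans ?_) (ENNReal.ofReal_lt_top (r := M))
  refine liminf_le_of_le (by isBoundedDefault) fun b hb => ?_
  obtain ⟨n, hn⟩ := hb.exists
  refine hn.trans ?_
  rw [← ofReal_integral_eq_lintegral_ofReal (hint n)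
    (ae_of_all _ fun x => le_min (hpos x) n.cast_nonneg)]
  exact ENNReal.ofReal_le_ofReal (hbd n)

theorem UdBound.integrable_of_growth (hU : UdBound K ν c₁ ρ d) (t : ℕ) (w : Wsp dW)
    {f : Wsp dW → ℝ} (hf : Measurable f) {a : ℝ} (hfa : ∀ w', |f w'| ≤ a * (1 + ‖w'‖ ^ d)) :
    Integrable f (kiter K t w) :=
  ((hU.integrable_kiter t w).const_mul a).mono' hf.aestronglyMeasurable (ae_of_all _ hfa)

theorem UdBound.integrable_stationary_of_growth (hU : UdBound K ν c₁ ρ d)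
    {f : Wsp dW → ℝ} (hf : Measurable f) {a : ℝ} (hfa : ∀ w', |f w'| ≤ a * (1 + ‖w'‖ ^ d)) :
    Integrable f ν :=
  (hU.1.const_mul a).mono' hf.aestronglyMeasurable (ae_of_all _ hfa)

theorem UdBound.abs_integral_sub_le (hU : UdBound K ν c₁ ρ d) (t : ℕ) (w : Wsp dW)
    {f : Wsp dW → ℝ} (hf : Measurable f) {a : ℝ} (ha : 0 ≤ a)
    (hfa : ∀ w', |f w'| ≤ a * (1 + ‖w'‖ ^ d)) :
    |(∫ x, f x ∂(kiter K t w)) - ∫ x, f x ∂ν| ≤ a * (c₁ * ρ ^ t * (1 + ‖w‖ ^ d)) := by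
  rcases ha.eq_or_lt with rfl | ha
  · have : f = 0 := funext fun x => abs_nonpos_iff.1 ((hfa x).trans_eq (zero_mul _))
    simp [this]
  set g : ℕ → Wsp dW → ℝ := fun n x => max (-(n : ℝ)) (min (f x / a) n) with hg
  have hgm : ∀ n, Measurable (g n) := fun n => by
    simp only [hg]; fun_prop
  have hgf : ∀ n x, |g n x| ≤ |f x / a| := by
    intro n x
    have hn : (0 : ℝ) ≤ n := n.cast_nonneg
    simp only [hg]
    rcases le_total 0 (f x / a) with h | h
    · rw [abs_of_nonneg (le_max_of_le_right (le_min h hn)), abs_of_nonneg h]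
      exact max_le (by linarith) (min_le_left _ _)
    · rw [min_eq_left (h.trans hn), abs_of_nonpos h, abs_of_nonpos (max_le (by linarith) h)]
      exact neg_le_neg (le_max_right _ _)
  have hgd : ∀ n x, |g n x| ≤ 1 + ‖x‖ ^ d := fun n x => (hgf n x).trans (by
    rw [abs_div, abs_of_pos ha, div_le_iff₀ ha, mul_comm]; exact hfa x)
  have hgb : ∀ n x, |g n x| ≤ (n : ℝ) := fun n x => by
    have hn : (0 : ℝ) ≤ n := n.cast_nonneg
    exact abs_le.2 ⟨le_max_left _ _, max_le (by linarith) (min_le_right _ _)⟩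
  have hlim : ∀ x, Tendsto (fun n => g n x) atTop (nhds (f x / a)) := fun x => by
    refine tendsto_const_nhds.congr' ?_
    obtain ⟨n, hn⟩ := exists_nat_ge |f x / a|
    filter_upwards [eventually_ge_atTop n] with k hk
    have hk' := abs_le.1 (hn.trans (show (n : ℝ) ≤ k by exact_mod_cast hk))
    simp only [hg]
    rw [min_eq_left hk'.2, max_eq_right hk'.1]
  have h1 : Tendsto (fun n => ∫ x, g n x ∂(kiter K t w)) atTop
      (nhds (∫ x, f x / a ∂(kiter K t w))) :=
    tendsto_integral_of_dominated_convergence _ (fun n => (hgm n).aestronglyMeasurable)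
      (hU.integrable_kiter t w) (fun n => ae_of_all _ (hgd n)) (ae_of_all _ hlim)
  have h2 : Tendsto (fun n => ∫ x, g n x ∂ν) atTop (nhds (∫ x, f x / a ∂ν)) :=
    tendsto_integral_of_dominated_convergence _ (fun n => (hgm n).aestronglyMeasurable)
      hU.1 (fun n => ae_of_all _ (hgd n)) (ae_of_all _ hlim)
  have h3 := le_of_tendsto (h1.sub h2).abs (Eventually.of_forall fun n =>
    hU.abs_integral_sub_le_of_bounded t w (hgm n) (hgd n) (hgb n))
  rw [integral_div, integral_div, ← sub_div, abs_div, abs_of_pos ha, div_le_iff₀ ha] at h3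
  linarith

end Ergodic

/-- The solution of the Poisson equation `u - K u = f - ∫ f dν`, as a series. -/
def poissonSol {α : Type*} [MeasurableSpace α] (K : Kernel α α) (ν : Measure α) (f : α → ℝ)
    (w : α) : ℝ :=
  ∑' n : ℕ, ((∫ x, f x ∂(kiter K n w)) - ∫ x, f x ∂ν)

section Poisson

variable {dW : ℕ} {K : Kernel (Wsp dW) (Wsp dW)} [IsMarkovKernel K]
  {ν : Measure (Wsp dW)} [IsProbabilityMeasure ν] {c₁ ρ : ℝ}

theorem UdBound.abs_poisson_term_le (hU : UdBound K ν c₁ ρ 1)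
    {f : Wsp dW → ℝ} (hf : Measurable f) {a : ℝ} (ha : 0 ≤ a)
    (hfa : ∀ w', |f w'| ≤ a * (1 + ‖w'‖)) (n : ℕ) (w : Wsp dW) :
    |(∫ x, f x ∂(kiter K n w)) - ∫ x, f x ∂ν| ≤ (a * c₁ * (1 + ‖w‖)) * ρ ^ n := by
  have h := hU.abs_integral_sub_le n w hf ha (by simpa only [Real.rpow_one] using hfa)
  rw [Real.rpow_one] at h
  exact h.trans_eq (by ring)

theorem UdBound.summable_poisson (hU : UdBound K ν c₁ ρ 1) (hρ₀ : 0 ≤ ρ) (hρ₁ : ρ < 1)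
    {f : Wsp dW → ℝ} (hf : Measurable f) {a : ℝ} (ha : 0 ≤ a)
    (hfa : ∀ w', |f w'| ≤ a * (1 + ‖w'‖)) (w : Wsp dW) :
    Summable fun n : ℕ => (∫ x, f x ∂(kiter K n w)) - ∫ x, f x ∂ν :=
  Summable.of_norm_bounded ((summable_geometric_of_lt_one hρ₀ hρ₁).mul_left _)
    fun n => hU.abs_poisson_term_le hf ha hfa n w

theorem UdBound.abs_poissonSol_le (hU : UdBound K ν c₁ ρ 1) (hρ₀ : 0 ≤ ρ) (hρ₁ : ρ < 1)
    {f : Wsp dW → ℝ} (hf : Measurable f) {a : ℝ} (ha : 0 ≤ a)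
    (hfa : ∀ w', |f w'| ≤ a * (1 + ‖w'‖)) (w : Wsp dW) :
    |poissonSol K ν f w| ≤ a * (c₁ / (1 - ρ)) * (1 + ‖w‖) := by
  have h : |poissonSol K ν f w| ≤ a * c₁ * (1 + ‖w‖) * (1 - ρ)⁻¹ :=
    tsum_of_norm_bounded (f := fun n => (∫ x, f x ∂(kiter K n w)) - ∫ x, f x ∂ν)
      ((hasSum_geometric_of_lt_one hρ₀ hρ₁).mul_left _)
      fun n => hU.abs_poisson_term_le hf ha hfa n w
  refine h.trans_eq ?_
  rw [div_eq_mul_inv]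
  ring

theorem UdBound.poissonSol_sub (hU : UdBound K ν c₁ ρ 1) (hρ₀ : 0 ≤ ρ) (hρ₁ : ρ < 1)
    {f g : Wsp dW → ℝ} (hf : Measurable f) (hg : Measurable g) {a b : ℝ} (ha : 0 ≤ a)
    (hb : 0 ≤ b) (hfa : ∀ w', |f w'| ≤ a * (1 + ‖w'‖)) (hgb : ∀ w', |g w'| ≤ b * (1 + ‖w'‖))
    (w : Wsp dW) :
    poissonSol K ν (fun x => f x - g x) w = poissonSol K ν f w - poissonSol K ν g w := by
  unfold poissonSol
  rw [← (hU.summable_poisson hρ₀ hρ₁ hf ha hfa w).tsum_sub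
    (hU.summable_poisson hρ₀ hρ₁ hg hb hgb w)]
  refine tsum_congr fun n => ?_
  have hfa' : ∀ w', |f w'| ≤ a * (1 + ‖w'‖ ^ (1 : ℝ)) := by simpa only [Real.rpow_one] using hfa
  have hgb' : ∀ w', |g w'| ≤ b * (1 + ‖w'‖ ^ (1 : ℝ)) := by simpa only [Real.rpow_one] using hgb
  rw [integral_sub (hU.integrable_of_growth n w hf hfa') (hU.integrable_of_growth n w hg hgb'),
    integral_sub (hU.integrable_stationary_of_growth hf hfa')
      (hU.integrable_stationary_of_growth hg hgb')]
  ring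

theorem measurable_poissonSol {Θ : Type*} [MeasurableSpace Θ] {g : Wsp dW → Θ → ℝ}
    (hg : Measurable fun p : Wsp dW × Θ => g p.1 p.2) :
    Measurable fun p : Wsp dW × Θ => poissonSol K ν (fun x => g x p.2) p.1 := by
  have h : StronglyMeasurable (Function.uncurry fun (p : Wsp dW × Θ) (x : Wsp dW) =>
      g x p.2) :=
    (hg.comp (measurable_snd.prodMk (measurable_snd.comp measurable_fst))).stronglyMeasurable
  unfold poissonSol
  refine Measurable.tsum fun n => Measurable.sub ?_ ?_
  · exact (h.integral_kernel_prod_right (κ := (kiter K n).comap Prod.fst measurable_fst)).measurable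
  · exact (h.integral_prod_right (ν := ν)).measurable

theorem UdBound.integral_poissonSol (hU : UdBound K ν c₁ ρ 1) (hρ₀ : 0 ≤ ρ) (hρ₁ : ρ < 1)
    {f : Wsp dW → ℝ} (hf : Measurable f) {a : ℝ} (ha : 0 ≤ a)
    (hfa : ∀ w', |f w'| ≤ a * (1 + ‖w'‖)) (w : Wsp dW) :
    ∫ x, poissonSol K ν f x ∂(K w) = poissonSol K ν f w - (f w - ∫ x, f x ∂ν) := by
  have hfa' : ∀ w', |f w'| ≤ a * (1 + ‖w'‖ ^ (1 : ℝ)) := by simpa only [Real.rpow_one] using hfa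
  have hbd := hU.abs_poisson_term_le hf ha hfa
  have hint : Integrable (fun x => 1 + ‖x‖) (K w) := by
    have h := hU.integrable_kiter 1 w
    simpa only [Real.rpow_one, kiter_one] using h
  have hmeas : ∀ n, Measurable fun w' => (∫ x, f x ∂(kiter K n w')) - ∫ x, f x ∂ν := fun n =>
    (hf.stronglyMeasurable.integral_kernel.measurable).sub_const _
  have hFint : ∀ n, Integrable (fun w' => (∫ x, f x ∂(kiter K n w')) - ∫ x, f x ∂ν) (K w) :=
    fun n => (hint.const_mul (a * c₁ * ρ ^ n)).mono' (hmeas n).aestronglyMeasurable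
      (ae_of_all _ fun w' => (hbd n w').trans_eq (by ring))
  have hsum : Summable fun n => ∫ w', ‖(∫ x, f x ∂(kiter K n w')) - ∫ x, f x ∂ν‖ ∂(K w) := by
    refine Summable.of_nonneg_of_le (fun n => integral_nonneg fun _ => norm_nonneg _) (fun n => ?_)
      ((summable_geometric_of_lt_one hρ₀ hρ₁).mul_left (a * c₁ * ∫ x, (1 + ‖x‖) ∂(K w)))
    calc ∫ w', ‖(∫ x, f x ∂(kiter K n w')) - ∫ x, f x ∂ν‖ ∂(K w)
        ≤ ∫ w', (a * c₁ * ρ ^ n) * (1 + ‖w'‖) ∂(K w) :=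
          integral_mono (hFint n).norm (hint.const_mul _)
            fun w' => (hbd n w').trans_eq (by ring)
      _ = a * c₁ * (∫ x, (1 + ‖x‖) ∂(K w)) * ρ ^ n := by rw [integral_const_mul]; ring
  unfold poissonSol
  rw [← (hasSum_integral_of_summable_integral_norm hFint hsum).tsum_eq,
    (hU.summable_poisson hρ₀ hρ₁ hf ha hfa w).tsum_eq_zero_add]
  have h0 : ∫ x, f x ∂(kiter K 0 w) = f w := by
    rw [kiter_zero_apply, integral_dirac]
  have hstep : ∀ n, ∫ w', ((∫ x, f x ∂(kiter K n w')) - ∫ x, f x ∂ν) ∂(K w)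
      = (∫ x, f x ∂(kiter K (n + 1) w)) - ∫ x, f x ∂ν := by
    intro n
    have hi : Integrable f (((kiter K n).comp K) w) := hU.integrable_of_growth (n + 1) w hf hfa'
    rw [integral_sub hi.integral_comp (integrable_const _), kiter_succ, Kernel.integral_comp hi]
    simp
  rw [h0, tsum_congr hstep]
  ring

end Poisson

section Markov

variable {dW : ℕ} {Ω : Type*} [mΩ : MeasurableSpace Ω] {K : Kernel (Wsp dW) (Wsp dW)}
  {P : Measure Ω} {Wp : ℕ → Ω → Wsp dW} {w : Wsp dW}

/-- The filtration generated by a Markov process. -/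
def IsMarkovProc.filtration (hMP : IsMarkovProc K P Wp w) : Filtration ℕ mΩ where
  seq t := ⨆ s ∈ Finset.range (t + 1), MeasurableSpace.comap (Wp s) inferInstance
  mono' := fun _ _ hij => biSup_mono fun _ hs =>
    Finset.range_subset_range.2 (Nat.succ_le_succ hij) hs
  le' := fun _ => iSup₂_le fun s _ => (hMP.meas s).comap_le

theorem IsMarkovProc.measurable_filtration (hMP : IsMarkovProc K P Wp w) {s t : ℕ}
    (hst : s ≤ t) : Measurable[hMP.filtration t] (Wp s) :=
  measurable_iff_comap_le.2 (le_iSup₂_of_le s (Finset.mem_range.2 (Nat.lt_succ_of_le hst)) le_rfl)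

variable [IsMarkovKernel K] [IsProbabilityMeasure P]

theorem IsMarkovProc.measure_inter_preimage (hMP : IsMarkovProc K P Wp w) (t : ℕ) {A : Set Ω}
    (hA : MeasurableSet[hMP.filtration t] A) {U : Set (Wsp dW)} (hU : MeasurableSet U) :
    P (A ∩ Wp (t + 1) ⁻¹' U) = ∫⁻ ω in A, K (Wp t ω) U ∂P := by
  have hle := hMP.filtration.le t
  have hfm : Measurable (U.indicator fun _ => (1 : ℝ)) := measurable_const.indicator hU
  have hbd : ∀ x, |U.indicator (fun _ => (1 : ℝ)) x| ≤ 1 := fun x => by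
    by_cases hx : x ∈ U <;> simp [hx]
  have hm : P[fun ω => U.indicator (fun _ => (1 : ℝ)) (Wp (t + 1) ω) | hMP.filtration t]
      =ᵐ[P] fun ω => ∫ x, U.indicator (fun _ => (1 : ℝ)) x ∂(K (Wp t ω)) :=
    hMP.markov t _ hfm ⟨1, hbd⟩
  have hint : Integrable (fun ω => U.indicator (fun _ => (1 : ℝ)) (Wp (t + 1) ω)) P :=
    Integrable.of_bound (hfm.comp (hMP.meas _)).aestronglyMeasurable 1
      (ae_of_all _ fun ω => hbd _)
  have h1 := setIntegral_condExp hle hint hA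
  rw [setIntegral_congr_ae (hle _ hA) (hm.mono fun ω h _ => h)] at h1
  have h2 : ∫ ω in A, U.indicator (fun _ => (1 : ℝ)) (Wp (t + 1) ω) ∂P
      = P.real (A ∩ Wp (t + 1) ⁻¹' U) := by
    have : (fun ω => U.indicator (fun _ => (1 : ℝ)) (Wp (t + 1) ω))
        = (Wp (t + 1) ⁻¹' U).indicator fun _ => (1 : ℝ) := rfl
    rw [this, setIntegral_indicator (hMP.meas _ hU)]
    simp
  have h3 : ∀ ω, ∫ x, U.indicator (fun _ => (1 : ℝ)) x ∂(K (Wp t ω)) = (K (Wp t ω) U).toReal :=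
    fun ω => by rw [integral_indicator hU]; simp [Measure.real]
  have hKm : Measurable fun ω => K (Wp t ω) U := (K.measurable_coe hU).comp (hMP.meas t)
  rw [h2] at h1
  simp only [h3] at h1
  rw [integral_toReal hKm.aemeasurable (ae_of_all _ fun ω => measure_lt_top _ _)] at h1
  refine ((ENNReal.toReal_eq_toReal_iff' ?_ (measure_ne_top _ _)).1 h1).symm
  refine ne_of_lt (lt_of_le_of_lt (lintegral_mono fun ω => prob_le_one (μ := K (Wp t ω))) ?_)
  simp

theorem IsMarkovProc.map_eq_kiter (hMP : IsMarkovProc K P Wp w) (t : ℕ) :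
    P.map (Wp t) = kiter K t w := by
  induction t with
  | zero =>
    rw [kiter_zero_apply, Measure.map_congr (g := fun _ => w) hMP.init, Measure.map_const]
    simp
  | succ t ih =>
    ext U hU
    have h := hMP.measure_inter_preimage t MeasurableSet.univ hU
    rw [Set.univ_inter, Measure.restrict_univ] at h
    rw [Measure.map_apply (hMP.meas _) hU, h, kiter_succ', Kernel.comp_apply' _ _ _ hU, ← ih,
      lintegral_map (K.measurable_coe hU) (hMP.meas t)]

theorem IsMarkovProc.map_prod_eq_compProd (hMP : IsMarkovProc K P Wp w) {Θ : Type*}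
    [MeasurableSpace Θ] (t : ℕ) {A : Set Ω} (hA : MeasurableSet[hMP.filtration t] A)
    {θ : Ω → Θ} (hθ : Measurable[hMP.filtration t] θ) :
    (P.restrict A).map (fun ω => ((θ ω, Wp t ω), Wp (t + 1) ω))
      = ((P.restrict A).map fun ω => (θ ω, Wp t ω)).compProd
        (K.comap Prod.snd measurable_snd) := by
  have hle := hMP.filtration.le t
  have hX : Measurable[hMP.filtration t] fun ω => (θ ω, Wp t ω) :=
    hθ.prodMk (hMP.measurable_filtration le_rfl)
  have hX' : Measurable fun ω => (θ ω, Wp t ω) := hX.mono hle le_rfl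
  refine Measure.ext_prod fun {S U} hS hU => ?_
  have hAS := hA.inter (hX hS)
  rw [Measure.map_apply (hX'.prodMk (hMP.meas _)) (hS.prod hU),
    Measure.compProd_apply_prod hS hU, setLIntegral_map hS _ hX']
  · rw [Measure.restrict_apply (hX'.prodMk (hMP.meas _) (hS.prod hU)),
      Measure.restrict_restrict (hX' hS),
      Set.inter_comm ((fun ω => (θ ω, Wp t ω)) ⁻¹' S) A]
    refine Eq.trans ?_ (hMP.measure_inter_preimage t hAS hU)
    congr 1
    ext ω
    simp only [Set.mem_inter_iff, Set.mem_preimage, Set.mem_prod]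
    tauto
  · exact (Kernel.measurable_coe _ hU)

theorem IsMarkovProc.setIntegral_succ (hMP : IsMarkovProc K P Wp w) {Θ : Type*}
    [MeasurableSpace Θ] (t : ℕ) {A : Set Ω} (hA : MeasurableSet[hMP.filtration t] A)
    {θ : Ω → Θ} (hθ : Measurable[hMP.filtration t] θ) {φ : Wsp dW → Θ → ℝ}
    (hφ : Measurable fun p : Wsp dW × Θ => φ p.1 p.2)
    (hint : Integrable (fun ω => φ (Wp (t + 1) ω) (θ ω)) P) :
    ∫ ω in A, φ (Wp (t + 1) ω) (θ ω) ∂P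
      = ∫ ω in A, (∫ x, φ x (θ ω) ∂(K (Wp t ω))) ∂P := by
  have hle := hMP.filtration.le t
  have hθ' : Measurable θ := hθ.mono hle le_rfl
  have hX' : Measurable fun ω => (θ ω, Wp t ω) := hθ'.prodMk (hMP.meas t)
  have hψ : Measurable fun q : (Θ × Wsp dW) × Wsp dW => φ q.2 q.1.1 :=
    hφ.comp (measurable_snd.prodMk (measurable_fst.comp measurable_fst))
  have hmap := hMP.map_prod_eq_compProd t hA hθ
  have hi : Integrable (fun q : (Θ × Wsp dW) × Wsp dW => φ q.2 q.1.1)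
      (((P.restrict A).map fun ω => (θ ω, Wp t ω)).compProd
        (K.comap Prod.snd measurable_snd)) := by
    rw [← hmap, integrable_map_measure hψ.aestronglyMeasurable
      (hX'.prodMk (hMP.meas _)).aemeasurable]
    exact hint.restrict
  have h1 := Measure.integral_compProd hi
  rw [← hmap, integral_map (hX'.prodMk (hMP.meas _)).aemeasurable hψ.aestronglyMeasurable,
    integral_map hX'.aemeasurable] at h1
  · exact h1
  · have hsm : StronglyMeasurable (Function.uncurry fun (p : Θ × Wsp dW) (x : Wsp dW) =>
        φ x p.1) := hψ.stronglyMeasurable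
    exact (hsm.integral_kernel_prod_right
      (κ := K.comap Prod.snd measurable_snd)).aestronglyMeasurable

theorem IsMarkovProc.integrable_comp (hMP : IsMarkovProc K P Wp w) (t : ℕ) {f : Wsp dW → ℝ}
    (hf : Integrable f (kiter K t w)) : Integrable (fun ω => f (Wp t ω)) P := by
  rw [← hMP.map_eq_kiter t] at hf
  exact hf.comp_measurable (hMP.meas t)

theorem IsMarkovProc.integral_comp (hMP : IsMarkovProc K P Wp w) (t : ℕ) {f : Wsp dW → ℝ}
    (hf : Measurable f) : ∫ ω, f (Wp t ω) ∂P = ∫ x, f x ∂(kiter K t w) := by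
  rw [← hMP.map_eq_kiter t, integral_map (hMP.meas t).aemeasurable hf.aestronglyMeasurable]

theorem IsMarkovProc.second_moment (hMP : IsMarkovProc K P Wp w) {ν : Measure (Wsp dW)}
    [IsProbabilityMeasure ν] {c₁ ρ : ℝ} (hc₁ : 0 ≤ c₁) (hρ₀ : 0 ≤ ρ) (hρ₁ : ρ ≤ 1)
    (hU2 : UdBound K ν c₁ ρ 2) :
    (∀ t, Integrable (fun ω => (1 + ‖Wp t ω‖) ^ 2) P) ∧
      ∃ Q : ℝ, 0 ≤ Q ∧ ∀ t, ∫ ω, (1 + ‖Wp t ω‖) ^ 2 ∂P ≤ Q := by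
  have h2 : ∀ t, Integrable (fun ω => 1 + ‖Wp t ω‖ ^ 2) P := fun t => by
    have h := hMP.integrable_comp t (hU2.integrable_kiter t w)
    simpa only [Real.rpow_two] using h
  have hle : ∀ t ω, (1 + ‖Wp t ω‖) ^ 2 ≤ 2 * (1 + ‖Wp t ω‖ ^ 2) := fun t ω => by
    nlinarith [sq_nonneg (1 - ‖Wp t ω‖)]
  have h1 : ∀ t, Integrable (fun ω => (1 + ‖Wp t ω‖) ^ 2) P := fun t => by
    refine ((h2 t).const_mul 2).mono' ?_ (ae_of_all _ fun ω => ?_)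
    · exact ((measurable_const.add (hMP.meas t).norm).pow_const 2).aestronglyMeasurable
    · rw [Real.norm_eq_abs, abs_of_nonneg (by positivity)]
      exact hle t ω
  have hmeas : Measurable fun x : Wsp dW => 1 + ‖x‖ ^ (2 : ℝ) := by fun_prop
  refine ⟨h1, 2 * ((∫ x, (1 + ‖x‖ ^ (2 : ℝ)) ∂ν) + c₁ * (1 + ‖w‖ ^ (2 : ℝ))), ?_, fun t => ?_⟩
  · have : 0 ≤ ∫ x, (1 + ‖x‖ ^ (2 : ℝ)) ∂ν := integral_nonneg fun x => by positivity
    positivity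
  · refine (integral_mono (h1 t) ((h2 t).const_mul 2) (hle t)).trans ?_
    rw [integral_const_mul]
    have h3 := hU2.abs_integral_sub_le t w hmeas zero_le_one fun x => by
      rw [abs_of_nonneg (by positivity), one_mul]
    have h4 := hMP.integral_comp t hmeas
    simp only [Real.rpow_two] at h3 h4 ⊢
    have h5 : c₁ * ρ ^ t * (1 + ‖w‖ ^ 2) ≤ c₁ * (1 + ‖w‖ ^ 2) := by
      refine mul_le_mul_of_nonneg_right ?_ (by positivity)
      exact mul_le_of_le_one_right hc₁ (pow_le_one₀ hρ₀ hρ₁)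
    linarith [(abs_le.1 h3).2]

end Markov

section RealPowers

theorem rpow_neg_mul_one_sub_inv_le {t κ : ℝ} (ht : 1 ≤ t) (hκ : κ ≤ 1) :
    t ^ (-κ) * (1 - 1 / t) ≤ (t + 1) ^ (-κ) := by
  have ht0 : 0 < t := by linarith
  have h1 : (t + 1) ^ (-κ) = t ^ (-κ) * ((t + 1) / t) ^ (-κ) := by
    rw [← Real.mul_rpow ht0.le (by positivity), mul_div_cancel₀ _ ht0.ne']
  rw [h1]
  refine mul_le_mul_of_nonneg_left ?_ (by positivity)
  have h2 : ((t + 1) / t) ^ (-1 : ℝ) ≤ ((t + 1) / t) ^ (-κ) :=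
    Real.rpow_le_rpow_of_exponent_le (by rw [le_div_iff₀ ht0]; linarith) (by linarith)
  refine le_trans ?_ h2
  rw [Real.rpow_neg_one, inv_div, sub_le_iff_le_add, div_add_div _ _ (by positivity) ht0.ne',
    le_div_iff₀ (by positivity)]
  nlinarith

theorem rpow_add_one_le {t a : ℝ} (ht : 1 ≤ t) (ha : a ≤ 1) :
    (t + 1) ^ a ≤ t ^ a * (1 + 1 / t) := by
  have ht0 : 0 < t := by linarith
  have h1 : (t + 1) ^ a = t ^ a * (1 + 1 / t) ^ a := by
    rw [← Real.mul_rpow ht0.le (by positivity)]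
    congr 1
    field_simp
  rw [h1]
  refine mul_le_mul_of_nonneg_left ?_ (by positivity)
  have hb : 1 ≤ 1 + 1 / t := by simp [ht0.le]
  simpa using Real.rpow_le_rpow_of_exponent_le hb ha

theorem rpow_neg_le_sub {t r : ℝ} (ht : 1 ≤ t) (hr0 : 0 ≤ r) (hr1 : r ≤ 1) :
    r / 2 * t ^ (-(r + 1)) ≤ t ^ (-r) - (t + 1) ^ (-r) := by
  have ht0 : 0 < t := by linarith
  have h1 : (t + 1) ^ (-r) = t ^ (-r) * (t / (t + 1)) ^ r := by
    rw [Real.div_rpow ht0.le (by positivity), Real.rpow_neg (by positivity : (0 : ℝ) ≤ t + 1),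
      Real.rpow_neg ht0.le]
    have : t ^ r ≠ 0 := by positivity
    field_simp
  have h2 : (t / (t + 1)) ^ r ≤ 1 - r / (t + 1) := by
    have h := rpow_one_add_le_one_add_mul_self (s := -(1 / (t + 1))) (p := r)
      (by rw [neg_le_neg_iff, div_le_one (by positivity)]; linarith) hr0 hr1
    have e : (1 : ℝ) + -(1 / (t + 1)) = t / (t + 1) := by field_simp; ring
    rw [e] at h
    exact h.trans_eq (by ring)
  have h3 : t ^ (-(r + 1)) = t ^ (-r) * (1 / t) := by
    rw [neg_add, Real.rpow_add ht0, Real.rpow_neg_one, one_div]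
  have h4 : r / 2 * (1 / t) ≤ r / (t + 1) := by
    rw [div_mul_div_comm, mul_one, div_le_div_iff₀ (by positivity) (by positivity)]
    nlinarith
  rw [h1, h3]
  have h5 : 0 < t ^ (-r) := by positivity
  nlinarith

theorem sum_rpow_neg_le {T : ℕ} (hT : 1 ≤ T) {r : ℝ} (hr0 : 0 < r) (hr1 : r ≤ 1) (n : ℕ) :
    ∑ s ∈ Finset.range n, ((T + s : ℕ) : ℝ) ^ (-(r + 1)) ≤ 2 / r * (T : ℝ) ^ (-r) := by
  have h : ∀ n : ℕ, r / 2 * ∑ s ∈ Finset.range n, ((T + s : ℕ) : ℝ) ^ (-(r + 1))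
      ≤ (T : ℝ) ^ (-r) - ((T + n : ℕ) : ℝ) ^ (-r) := by
    intro n
    induction n with
    | zero => simp
    | succ n ih =>
      rw [Finset.sum_range_succ, mul_add]
      have h := rpow_neg_le_sub (t := ((T + n : ℕ) : ℝ)) (r := r)
        (by exact_mod_cast hT.trans (Nat.le_add_right _ _)) hr0.le hr1
      have e : ((T + (n + 1) : ℕ) : ℝ) = ((T + n : ℕ) : ℝ) + 1 := by push_cast; ring
      rw [e]
      linarith
  have h1 := h n
  have h2 : 0 ≤ ((T + n : ℕ) : ℝ) ^ (-r) := by positivity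
  rw [div_mul_eq_mul_div, le_div_iff₀ hr0]
  linarith

theorem exists_forall_rpow_neg_bounds {κ c z : ℝ} (hκ0 : 0 < κ) (hκ1 : κ < 1) (hc : 0 < c) :
    ∃ t₀ : ℕ, 1 ≤ t₀ ∧ ∀ t : ℕ, t₀ ≤ t →
      1 / (t : ℝ) ≤ c * (t : ℝ) ^ (-κ) ∧ z * (t : ℝ) ^ (-κ) ≤ 1 := by
  have h1 : Tendsto (fun t : ℕ => (t : ℝ) ^ (-(1 - κ))) atTop (nhds 0) :=
    (tendsto_rpow_neg_atTop (by linarith)).comp tendsto_natCast_atTop_atTop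
  have h2 : Tendsto (fun t : ℕ => z * (t : ℝ) ^ (-κ)) atTop (nhds 0) := by
    simpa using ((tendsto_rpow_neg_atTop hκ0).comp tendsto_natCast_atTop_atTop).const_mul z
  obtain ⟨t₀, ht₀⟩ := eventually_atTop.1
    ((h1.eventually (ge_mem_nhds hc)).and (h2.eventually (ge_mem_nhds one_pos)))
  refine ⟨max t₀ 1, le_max_right _ _, fun t ht => ?_⟩
  obtain ⟨h3, h4⟩ := ht₀ t ((le_max_left _ _).trans ht)
  refine ⟨?_, h4⟩
  have ht0 : (0 : ℝ) < t := by exact_mod_cast (le_max_right _ _).trans ht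
  have e : 1 / (t : ℝ) = (t : ℝ) ^ (-(1 - κ)) * (t : ℝ) ^ (-κ) := by
    rw [← Real.rpow_add ht0, one_div, ← Real.rpow_neg_one]
    congr 1
    ring
  rw [e]
  exact mul_le_mul_of_nonneg_right h3 (by positivity)

theorem rpow_neg_two_mul {t : ℝ} (ht : 0 < t) (κ : ℝ) :
    t ^ (-(2 * κ)) = t ^ (-κ) * t ^ (-κ) := by
  rw [← Real.rpow_add ht]
  congr 1
  ring

/-- A form of Chung's lemma. -/
theorem exists_le_mul_rpow_neg_of_recursion {κ z b : ℝ} (hκ0 : 0 < κ) (hκ1 : κ < 1) (hz : 0 < z)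
    (hb : 0 ≤ b) {a : ℕ → ℝ}
    (ha : ∀ t : ℕ, 1 ≤ t →
      a (t + 1) ≤ (1 - z * (t : ℝ) ^ (-κ)) * a t + b * (t : ℝ) ^ (-(2 * κ))) :
    ∃ D : ℝ, 0 ≤ D ∧ ∀ t : ℕ, 1 ≤ t → a t ≤ D * (t : ℝ) ^ (-κ) := by
  obtain ⟨t₀, ht₀1, ht₀⟩ := exists_forall_rpow_neg_bounds (z := z) hκ0 hκ1 (half_pos hz)
  set D : ℝ := 2 * b / z + ∑ t ∈ Finset.range (t₀ + 1), |a t| * (t : ℝ) ^ κ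
  have hsum : ∀ t : ℕ, 0 ≤ |a t| * (t : ℝ) ^ κ := fun t => by positivity
  have hD1 : 2 * b / z ≤ D := le_add_of_nonneg_right (Finset.sum_nonneg fun t _ => hsum t)
  have hD0 : 0 ≤ D := le_trans (by positivity) hD1
  have hsmall : ∀ t : ℕ, 1 ≤ t → t ≤ t₀ → a t ≤ D * (t : ℝ) ^ (-κ) := by
    intro t ht1 ht
    have ht0 : (0 : ℝ) < t := by exact_mod_cast ht1
    have h1 : |a t| * (t : ℝ) ^ κ ≤ D :=
      (Finset.single_le_sum (f := fun t : ℕ => |a t| * (t : ℝ) ^ κ) (fun t _ => hsum t)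
        (Finset.mem_range.2 (Nat.lt_succ_of_le ht))).trans
        (le_add_of_nonneg_left (by positivity))
    rw [Real.rpow_neg ht0.le, ← div_eq_mul_inv, le_div_iff₀ (by positivity)]
    exact (mul_le_mul_of_nonneg_right (le_abs_self _) (by positivity)).trans h1
  refine ⟨D, hD0, fun t ht1 => ?_⟩
  rcases le_total t t₀ with h | h
  · exact hsmall t ht1 h
  · induction t, h using Nat.le_induction with
    | base => exact hsmall t₀ ht1 le_rfl
    | succ t ht ih =>
      have ht1' : 1 ≤ t := ht₀1.trans ht
      have ih := ih ht1'
      have ht0 : (0 : ℝ) < t := by exact_mod_cast ht1'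
      obtain ⟨h1, h2⟩ := ht₀ t ht
      have h3 := rpow_neg_mul_one_sub_inv_le (t := (t : ℝ)) (κ := κ) (by exact_mod_cast ht1')
        hκ1.le
      have h4 := ha t ht1'
      rw [rpow_neg_two_mul ht0] at h4
      set τ := (t : ℝ) ^ (-κ)
      have hτ0 : 0 < τ := by positivity
      have h5 : b ≤ z / 2 * D := by
        rw [div_le_iff₀ hz] at hD1
        linarith
      push_cast
      calc a (t + 1) ≤ (1 - z * τ) * (D * τ) + b * (τ * τ) :=
            h4.trans (add_le_add_left (mul_le_mul_of_nonneg_left ih (by linarith)) _)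
        _ ≤ (1 - z * τ) * (D * τ) + (z / 2 * D) * (τ * τ) := by gcongr
        _ = D * (τ * (1 - z / 2 * τ)) := by ring
        _ ≤ D * (τ * (1 - 1 / t)) := by gcongr
        _ ≤ D * ((t : ℝ) + 1) ^ (-κ) := by gcongr

end RealPowers

theorem measure_exists_ge_le_of_le_add {Ω : Type*} {mΩ : MeasurableSpace Ω} {P : Measure Ω}
    [IsProbabilityMeasure P] {ℱ : Filtration ℕ mΩ} {U m g : ℕ → Ω → ℝ}
    (hUm : StronglyMeasurable[ℱ 0] (U 0)) (hmm : ∀ t, StronglyMeasurable[ℱ (t + 1)] (m t))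
    (hgm : ∀ t, StronglyMeasurable[ℱ (t + 1)] (g t)) (hUi : Integrable (U 0) P)
    (hmi : ∀ t, Integrable (m t) P) (hgi : ∀ t, Integrable (g t) P)
    (hU0 : ∀ t ω, 0 ≤ U t ω) (hg0 : ∀ t ω, 0 ≤ g t ω)
    (hm0 : ∀ t A, MeasurableSet[ℱ t] A → ∫ ω in A, m t ω ∂P = 0)
    (hstep : ∀ t ω, U (t + 1) ω ≤ U t ω + m t ω + g t ω) {b ε : ℝ} (hε : 0 < ε)
    (hb : ∀ n, ∑ s ∈ Finset.range n, ∫ ω, g s ω ∂P ≤ b) :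
    P {ω | ∃ t, ε ≤ U t ω} ≤ ENNReal.ofReal (((∫ ω, U 0 ω ∂P) + b) / ε) := by
  set S : ℕ → Ω → ℝ := fun n ω => U 0 ω + ∑ s ∈ Finset.range n, (m s ω + g s ω) with hS
  have hSsucc : ∀ n ω, S (n + 1) ω = S n ω + m n ω + g n ω := fun n ω => by
    simp only [hS, Finset.sum_range_succ]; ring
  have hSU : ∀ n ω, U n ω ≤ S n ω := fun n ω => by
    induction n with
    | zero => simp [hS]
    | succ n ih => rw [hSsucc]; linarith [hstep n ω]
  have hSi : ∀ n, Integrable (S n) P := fun n =>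
    hUi.add (integrable_finsetSum _ fun s _ => (hmi s).add (hgi s))
  have hSm : StronglyAdapted ℱ S := fun n => by
    induction n with
    | zero => simpa [hS] using hUm
    | succ n ih =>
      have e : S (n + 1) = fun ω => S n ω + m n ω + g n ω := funext (hSsucc n)
      rw [e]
      exact ((ih.mono (ℱ.mono n.le_succ)).add (hmm n)).add (hgm n)
  have hset : ∀ n A, MeasurableSet[ℱ n] A →
      ∫ ω in A, S (n + 1) ω ∂P = ∫ ω in A, S n ω ∂P + ∫ ω in A, g n ω ∂P := fun n A hA => by
    have h1 : ∫ ω in A, S (n + 1) ω ∂P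
        = ∫ ω in A, (S n ω + m n ω) ∂P + ∫ ω in A, g n ω ∂P := by
      simp only [hSsucc]
      exact integral_add ((hSi n).add (hmi n)).restrict (hgi n).restrict
    rw [h1, integral_add (hSi n).restrict (hmi n).restrict, hm0 n A hA, add_zero]
  have hsub : Submartingale S ℱ P :=
    submartingale_of_setIntegral_le_succ hSm hSi fun n A hA => by
      rw [hset n A hA]
      exact le_add_of_nonneg_right (integral_nonneg (hg0 n))
  have hES : ∀ n, ∫ ω, S n ω ∂P ≤ (∫ ω, U 0 ω ∂P) + b := fun n => by
    have h : ∫ ω, S n ω ∂P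
        = (∫ ω, U 0 ω ∂P) + ∑ s ∈ Finset.range n, ∫ ω, g s ω ∂P := by
      induction n with
      | zero => simp [hS]
      | succ n ih =>
        have h := hset n Set.univ MeasurableSet.univ
        simp only [Measure.restrict_univ] at h
        rw [h, ih, Finset.sum_range_succ, add_assoc]
    rw [h]
    linarith [hb n]
  set E : ℕ → Set Ω := fun n => {ω | (ε.toNNReal : ℝ) ≤
    (Finset.range (n + 1)).sup' Finset.nonempty_range_add_one fun k => S k ω}
  have hεe : (ε.toNNReal : ℝ) = ε := Real.coe_toNNReal _ hε.le
  have hEmono : Monotone E := fun i j hij ω hω =>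
    (show (ε.toNNReal : ℝ) ≤ _ from hω).trans (Finset.sup'_mono _
      (Finset.range_subset_range.2 (Nat.succ_le_succ hij)) _)
  have hPE : ∀ n, P (E n) ≤ ENNReal.ofReal (((∫ ω, U 0 ω ∂P) + b) / ε) := fun n => by
    have h := maximal_ineq hsub (fun n ω => (hU0 n ω).trans (hSU n ω)) (ε := ε.toNNReal) n
    have h2 : ∫ ω in E n, S n ω ∂P ≤ (∫ ω, U 0 ω ∂P) + b :=
      (setIntegral_le_integral (hSi n)
        (ae_of_all _ fun ω => (hU0 n ω).trans (hSU n ω))).trans (hES n)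
    rw [ENNReal.ofReal_div_of_pos hε,
      ENNReal.le_div_iff_mul_le (Or.inl (by simpa using hε)) (Or.inl ENNReal.ofReal_ne_top),
      mul_comm]
    exact h.trans (ENNReal.ofReal_le_ofReal h2)
  have hsubset : {ω | ∃ t, ε ≤ U t ω} ⊆ ⋃ n, E n := by
    rintro ω ⟨t, ht⟩
    refine Set.mem_iUnion.2 ⟨t, ?_⟩
    change (ε.toNNReal : ℝ) ≤ _
    rw [hεe]
    exact (ht.trans (hSU t ω)).trans
      (Finset.le_sup' (fun k => S k ω) (Finset.mem_range.2 t.lt_succ_self))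
  refine (measure_mono hsubset).trans ?_
  rw [hEmono.measure_iUnion]
  exact iSup_le hPE

/-- A Lyapunov recursion: `x` is controlled by `V`, which contracts at rate `z t ^ (-κ)` up to the
martingale increment `m` and the errors `y` and `q`. -/
structure LyapunovRecursion {Ω : Type*} {mΩ : MeasurableSpace Ω} (P : Measure Ω)
    (ℱ : Filtration ℕ mΩ) (κ z c : ℝ) (x V y q m : ℕ → Ω → ℝ) : Prop where
  meas_V : ∀ t, StronglyMeasurable[ℱ t] (V t)
  meas_y : ∀ t, StronglyMeasurable[ℱ t] (y t)
  meas_q : ∀ t, StronglyMeasurable[ℱ t] (q t)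
  meas_m : ∀ t, StronglyMeasurable[ℱ (t + 1)] (m t)
  int_x : ∀ t, Integrable (x t) P
  int_V : ∀ t, Integrable (V t) P
  int_y : ∀ t, Integrable (y t) P
  int_q : ∀ t, Integrable (q t) P
  int_m : ∀ t, Integrable (m t) P
  x_nonneg : ∀ t ω, 0 ≤ x t ω
  y_nonneg : ∀ t ω, 0 ≤ y t ω
  q_nonneg : ∀ t ω, 0 ≤ q t ω
  martingale : ∀ t A, MeasurableSet[ℱ t] A → ∫ ω in A, m t ω ∂P = 0
  lower : ∀ t : ℕ, 1 ≤ t → ∀ ω, x t ω / 2 ≤ V t ω + c * (t : ℝ) ^ (-(2 * κ)) * q t ω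
  step : ∀ t : ℕ, 1 ≤ t → ∀ ω, V (t + 1) ω ≤ (1 - z * (t : ℝ) ^ (-κ)) * V t ω + m t ω +
    c * ((t : ℝ) ^ (-κ) * y t ω + (t : ℝ) ^ (-(2 * κ)) * (q t ω + q (t + 1) ω))

namespace LyapunovRecursion

variable {Ω : Type*} {mΩ : MeasurableSpace Ω} {P : Measure Ω} {ℱ : Filtration ℕ mΩ}
  {κ z c Q Y : ℝ} {x V y q m : ℕ → Ω → ℝ}

theorem exists_integral_V_le (h : LyapunovRecursion P ℱ κ z c x V y q m) (hκ0 : 0 < κ)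
    (hκ1 : κ < 1) (hz : 0 < z) (hc : 0 ≤ c) (hQ : ∀ t, ∫ ω, q t ω ∂P ≤ Q) (hQ0 : 0 ≤ Q)
    (hY : ∀ t : ℕ, 1 ≤ t → ∫ ω, y t ω ∂P ≤ Y * (t : ℝ) ^ (-κ)) (hY0 : 0 ≤ Y) :
    ∃ D : ℝ, 0 ≤ D ∧ ∀ t : ℕ, 1 ≤ t → ∫ ω, V t ω ∂P ≤ D * (t : ℝ) ^ (-κ) := by
  refine exists_le_mul_rpow_neg_of_recursion hκ0 hκ1 hz (b := c * (Y + 2 * Q)) (by positivity)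
    fun t ht => ?_
  have ht0 : (0 : ℝ) < t := by exact_mod_cast ht
  have hm : ∫ ω, m t ω ∂P = 0 := by
    simpa using h.martingale t Set.univ MeasurableSet.univ
  have hV := (h.int_V t).const_mul (1 - z * (t : ℝ) ^ (-κ))
  have hy := (h.int_y t).const_mul ((t : ℝ) ^ (-κ))
  have hq : Integrable (fun ω => (t : ℝ) ^ (-(2 * κ)) * (q t ω + q (t + 1) ω)) P :=
    ((h.int_q t).add (h.int_q (t + 1))).const_mul _
  have hyq : Integrable (fun ω => (t : ℝ) ^ (-κ) * y t ω +
      (t : ℝ) ^ (-(2 * κ)) * (q t ω + q (t + 1) ω)) P := hy.add hq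
  have hVm : Integrable (fun ω => (1 - z * (t : ℝ) ^ (-κ)) * V t ω + m t ω) P :=
    hV.add (h.int_m t)
  have h1 : ∫ ω, V (t + 1) ω ∂P ≤ (1 - z * (t : ℝ) ^ (-κ)) * (∫ ω, V t ω ∂P) +
      c * ((t : ℝ) ^ (-κ) * (∫ ω, y t ω ∂P) + (t : ℝ) ^ (-(2 * κ)) *
        ((∫ ω, q t ω ∂P) + ∫ ω, q (t + 1) ω ∂P)) := by
    refine (integral_mono (h.int_V _) (hVm.add (hyq.const_mul c)) (h.step t ht)).trans_eq ?_
    simp only [Pi.add_apply]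
    rw [integral_add hVm (hyq.const_mul c), integral_add hV (h.int_m t), hm, add_zero,
      integral_const_mul, integral_const_mul, integral_add hy hq, integral_const_mul,
      integral_const_mul, integral_add (h.int_q t) (h.int_q (t + 1))]
  refine h1.trans ?_
  have h2 := hY t ht
  have h3 := hQ t
  have h4 := hQ (t + 1)
  rw [rpow_neg_two_mul ht0]
  have hτ : 0 < (t : ℝ) ^ (-κ) := by positivity
  calc _ ≤ (1 - z * (t : ℝ) ^ (-κ)) * (∫ ω, V t ω ∂P) +
      c * ((t : ℝ) ^ (-κ) * (Y * (t : ℝ) ^ (-κ)) + (t : ℝ) ^ (-κ) * (t : ℝ) ^ (-κ) *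
        (Q + Q)) := by gcongr
    _ = _ := by ring

theorem exists_integral_x_le (h : LyapunovRecursion P ℱ κ z c x V y q m) (hκ0 : 0 < κ)
    (hκ1 : κ < 1) (hz : 0 < z) (hc : 0 ≤ c) (hQ : ∀ t, ∫ ω, q t ω ∂P ≤ Q) (hQ0 : 0 ≤ Q)
    (hY : ∀ t : ℕ, 1 ≤ t → ∫ ω, y t ω ∂P ≤ Y * (t : ℝ) ^ (-κ)) (hY0 : 0 ≤ Y) :
    ∃ D : ℝ, 0 ≤ D ∧ ∀ t : ℕ, 1 ≤ t → ∫ ω, x t ω ∂P ≤ D * (t : ℝ) ^ (-κ) := by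
  obtain ⟨D, hD0, hD⟩ := h.exists_integral_V_le hκ0 hκ1 hz hc hQ hQ0 hY hY0
  refine ⟨2 * (D + c * Q), by positivity, fun t ht => ?_⟩
  have ht1 : (1 : ℝ) ≤ t := by exact_mod_cast ht
  have hq := (h.int_q t).const_mul (c * (t : ℝ) ^ (-(2 * κ)))
  have h1 := integral_mono ((h.int_x t).div_const 2) ((h.int_V t).add hq) (h.lower t ht)
  simp only [Pi.add_apply] at h1
  rw [integral_add (h.int_V t) hq, integral_const_mul, integral_div] at h1
  have h2 : (t : ℝ) ^ (-(2 * κ)) ≤ (t : ℝ) ^ (-κ) :=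
    Real.rpow_le_rpow_of_exponent_le ht1 (by linarith)
  have h3 : c * (t : ℝ) ^ (-(2 * κ)) * (∫ ω, q t ω ∂P) ≤ c * (t : ℝ) ^ (-κ) * Q :=
    mul_le_mul (by gcongr) (hQ t) (integral_nonneg (h.q_nonneg t)) (by positivity)
  have h4 := hD t ht
  linarith

theorem exists_tail_bound [IsProbabilityMeasure P]
    (h : LyapunovRecursion P ℱ κ z c x V y q m) (hκ0 : 0 < κ)
    (hκ1 : κ < 1) (hz : 0 < z) (hc : 0 ≤ c) (hQ : ∀ t, ∫ ω, q t ω ∂P ≤ Q) (hQ0 : 0 ≤ Q)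
    (hY : ∀ t : ℕ, 1 ≤ t → ∫ ω, y t ω ∂P ≤ Y * (t : ℝ) ^ (-κ)) (hY0 : 0 ≤ Y)
    {a ε : ℝ} (ha : a < 2 * κ - 1) (ha0 : 0 ≤ a) (hε : 0 < ε) :
    ∃ M : ℝ, 0 ≤ M ∧ ∃ T₀ : ℕ, ∀ T : ℕ, T₀ ≤ T →
      P {ω | ∃ t : ℕ, T ≤ t ∧ ε ≤ (t : ℝ) ^ a * x t ω}
        ≤ ENNReal.ofReal (M * (T : ℝ) ^ (-(2 * κ - 1 - a))) := by
  obtain ⟨D, hD0, hD⟩ := h.exists_integral_V_le hκ0 hκ1 hz hc hQ hQ0 hY hY0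
  obtain ⟨T₀, hT₀1, hT₀⟩ := exists_forall_rpow_neg_bounds (z := z) hκ0 hκ1 hz
  set r := 2 * κ - 1 - a with hr
  have hr0 : 0 < r := by linarith
  have hr1 : r ≤ 1 := by linarith
  set G : ℝ := c * (2 * Y + 6 * Q) with hG
  have hG0 : 0 ≤ G := by positivity
  refine ⟨(D + c * Q + G * (2 / r)) * (2 / ε), by positivity, T₀, fun T hT => ?_⟩
  have hge : ∀ s, 1 ≤ T + s := fun s => hT₀1.trans (hT.trans (Nat.le_add_right _ _))
  have hpos : ∀ s, (0 : ℝ) < ((T + s : ℕ) : ℝ) := fun s => by exact_mod_cast hge s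
  let 𝒢 : Filtration ℕ mΩ :=
    ⟨fun s => ℱ (T + s), fun i j hij => ℱ.mono (Nat.add_le_add_left hij T), fun s => ℱ.le _⟩
  let U : ℕ → Ω → ℝ := fun s ω => ((T + s : ℕ) : ℝ) ^ a *
    (V (T + s) ω + c * ((T + s : ℕ) : ℝ) ^ (-(2 * κ)) * q (T + s) ω)
  let N : ℕ → Ω → ℝ := fun s ω => ((T + s + 1 : ℕ) : ℝ) ^ a * m (T + s) ω
  let E : ℕ → Ω → ℝ := fun s ω => c * ((T + s : ℕ) : ℝ) ^ a *
    (2 * (((T + s : ℕ) : ℝ) ^ (-κ) * y (T + s) ω) +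
      ((T + s : ℕ) : ℝ) ^ (-(2 * κ)) * (3 * (q (T + s) ω + q (T + s + 1) ω)))
  have hUx : ∀ s ω, ((T + s : ℕ) : ℝ) ^ a * (x (T + s) ω / 2) ≤ U s ω := fun s ω =>
    mul_le_mul_of_nonneg_left (h.lower _ (hge s) ω) (by positivity)
  have hU0 : ∀ s ω, 0 ≤ U s ω := fun s ω =>
    le_trans (mul_nonneg (by positivity) (by linarith [h.x_nonneg (T + s) ω])) (hUx s ω)
  have hE0 : ∀ s ω, 0 ≤ E s ω := fun s ω => by
    have := h.y_nonneg (T + s) ω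
    have := h.q_nonneg (T + s) ω
    have := h.q_nonneg (T + s + 1) ω
    positivity
  have hstep : ∀ s ω, U (s + 1) ω ≤ U s ω + N s ω + E s ω := by
    intro s ω
    have ht1 : (1 : ℝ) ≤ ((T + s : ℕ) : ℝ) := by exact_mod_cast hge s
    obtain ⟨hb1, hb2⟩ := hT₀ (T + s) (hT.trans (Nat.le_add_right _ _))
    have hstep := h.step (T + s) (hge s) ω
    have hUs := hU0 s ω
    have hw := rpow_add_one_le (a := a) ht1 (by linarith)
    have hw2 : (((T + s : ℕ) : ℝ) + 1) ^ a * (((T + s : ℕ) : ℝ) + 1) ^ (-(2 * κ))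
        ≤ ((T + s : ℕ) : ℝ) ^ a * ((T + s : ℕ) : ℝ) ^ (-(2 * κ)) := by
      rw [← Real.rpow_add (hpos s), ← Real.rpow_add (by positivity)]
      exact Real.rpow_le_rpow_of_nonpos (hpos s) (by linarith) (by linarith)
    have hy := h.y_nonneg (T + s) ω
    have hq := h.q_nonneg (T + s) ω
    have hq' := h.q_nonneg (T + s + 1) ω
    have e1 : ((T + (s + 1) : ℕ) : ℝ) = ((T + s : ℕ) : ℝ) + 1 := by push_cast; ring
    have e2 : ((T + s + 1 : ℕ) : ℝ) = ((T + s : ℕ) : ℝ) + 1 := by push_cast; ring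
    simp only [U, N, E] at hUs ⊢
    rw [e1, e2, show T + (s + 1) = T + s + 1 from rfl]
    set t : ℝ := ((T + s : ℕ) : ℝ)
    have ht0 : 0 < t := by linarith
    have hwpos : 0 < t ^ a := by positivity
    have hτ : 0 < t ^ (-κ) := by positivity
    have hσ : 0 < t ^ (-(2 * κ)) := by positivity
    have hw' : (t + 1) ^ a ≤ 2 * t ^ a := by
      refine hw.trans ?_
      rw [mul_comm 2]
      refine mul_le_mul_of_nonneg_left ?_ hwpos.le
      have : 1 / t ≤ 1 := by rw [div_le_one ht0]; exact ht1
      linarith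
    have hk : (t + 1) ^ a * (1 - z * t ^ (-κ)) ≤ t ^ a := by
      calc (t + 1) ^ a * (1 - z * t ^ (-κ)) ≤ (t ^ a * (1 + 1 / t)) * (1 - z * t ^ (-κ)) :=
            mul_le_mul_of_nonneg_right hw (by linarith)
        _ ≤ (t ^ a * (1 + z * t ^ (-κ))) * (1 - z * t ^ (-κ)) := by
            refine mul_le_mul_of_nonneg_right ?_ (by linarith)
            gcongr
        _ = t ^ a * (1 - (z * t ^ (-κ)) ^ 2) := by ring
        _ ≤ t ^ a := mul_le_of_le_one_right hwpos.le (by linarith [sq_nonneg (z * t ^ (-κ))])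
    have hVq : 0 ≤ V (T + s) ω + c * t ^ (-(2 * κ)) * q (T + s) ω :=
      (mul_nonneg_iff_of_pos_left hwpos).1 hUs
    have hcq : 0 ≤ c * t ^ (-(2 * κ)) * q (T + s) ω := by positivity
    have h1 : (t + 1) ^ a * V (T + s + 1) ω
        ≤ (t + 1) ^ a * (1 - z * t ^ (-κ)) * V (T + s) ω + (t + 1) ^ a * m (T + s) ω +
          (t + 1) ^ a * (c * (t ^ (-κ) * y (T + s) ω +
            t ^ (-(2 * κ)) * (q (T + s) ω + q (T + s + 1) ω))) := by
      have := mul_le_mul_of_nonneg_left hstep (show 0 ≤ (t + 1) ^ a by positivity)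
      linarith
    have h2 : (t + 1) ^ a * (1 - z * t ^ (-κ)) * V (T + s) ω
        ≤ t ^ a * (V (T + s) ω + c * t ^ (-(2 * κ)) * q (T + s) ω) := by
      refine le_trans ?_ (mul_le_mul_of_nonneg_right hk hVq)
      refine mul_le_mul_of_nonneg_left (by linarith)
        (mul_nonneg (by positivity) (by linarith))
    have h3 : (t + 1) ^ a * (c * (t ^ (-κ) * y (T + s) ω +
          t ^ (-(2 * κ)) * (q (T + s) ω + q (T + s + 1) ω)))
        ≤ (2 * t ^ a) * (c * (t ^ (-κ) * y (T + s) ω +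
          t ^ (-(2 * κ)) * (q (T + s) ω + q (T + s + 1) ω))) :=
      mul_le_mul_of_nonneg_right hw' (by positivity)
    have h4 : ((t + 1) ^ a * (t + 1) ^ (-(2 * κ))) * (c * q (T + s + 1) ω)
        ≤ (t ^ a * t ^ (-(2 * κ))) * (c * q (T + s + 1) ω) :=
      mul_le_mul_of_nonneg_right hw2 (by positivity)
    have h5 : 0 ≤ t ^ a * t ^ (-(2 * κ)) * (c * q (T + s) ω) := by positivity
    linarith
  have hqi : ∀ s, Integrable (fun ω => 3 * (q (T + s) ω + q (T + s + 1) ω)) P := fun s =>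
    ((h.int_q _).add (h.int_q _)).const_mul 3
  have hi1 : ∀ s, Integrable (fun ω => 2 * (((T + s : ℕ) : ℝ) ^ (-κ) * y (T + s) ω)) P :=
    fun s => ((h.int_y _).const_mul _).const_mul 2
  have hEint : ∀ s, ∫ ω, E s ω ∂P ≤ G * ((T + s : ℕ) : ℝ) ^ (-(r + 1)) := by
    intro s
    simp only [E]
    rw [integral_const_mul, integral_add (hi1 s) ((hqi s).const_mul _), integral_const_mul,
      integral_const_mul, integral_const_mul, integral_const_mul,
      integral_add (h.int_q _) (h.int_q _)]
    have e : ((T + s : ℕ) : ℝ) ^ (-(r + 1))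
        = ((T + s : ℕ) : ℝ) ^ a * (((T + s : ℕ) : ℝ) ^ (-κ) * ((T + s : ℕ) : ℝ) ^ (-κ)) := by
      rw [← Real.rpow_add (hpos s), ← Real.rpow_add (hpos s)]
      congr 1
      rw [hr]; ring
    rw [e, rpow_neg_two_mul (hpos s)]
    have h2 := hY (T + s) (hge s)
    have h3 := hQ (T + s)
    have h4 := hQ (T + s + 1)
    calc _ ≤ c * ((T + s : ℕ) : ℝ) ^ a *
        (2 * (((T + s : ℕ) : ℝ) ^ (-κ) * (Y * ((T + s : ℕ) : ℝ) ^ (-κ))) +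
          ((T + s : ℕ) : ℝ) ^ (-κ) * ((T + s : ℕ) : ℝ) ^ (-κ) * (3 * (Q + Q))) := by gcongr
      _ = _ := by rw [hG]; ring
  have hqc : Integrable (fun ω => c * ((T : ℕ) : ℝ) ^ (-(2 * κ)) * q T ω) P :=
    (h.int_q T).const_mul _
  have hUi : Integrable (U 0) P := ((h.int_V T).add hqc).const_mul _
  have hEU : ∫ ω, U 0 ω ∂P ≤ (D + c * Q) * (T : ℝ) ^ (-r) := by
    simp only [U, add_zero]
    have hT1 : 1 ≤ T := hge 0
    have hT1' : (1 : ℝ) ≤ T := by exact_mod_cast hT1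
    have hT0 : (0 : ℝ) < T := by linarith
    rw [integral_const_mul, integral_add (h.int_V T) hqc, integral_const_mul]
    have h2 : (T : ℝ) ^ (-(2 * κ)) ≤ (T : ℝ) ^ (-κ) :=
      Real.rpow_le_rpow_of_exponent_le hT1' (by linarith)
    have h3 : c * (T : ℝ) ^ (-(2 * κ)) * (∫ ω, q T ω ∂P) ≤ c * (T : ℝ) ^ (-κ) * Q :=
      mul_le_mul (by gcongr) (hQ T) (integral_nonneg (h.q_nonneg T)) (by positivity)
    calc _ ≤ (T : ℝ) ^ a * (D * (T : ℝ) ^ (-κ) + c * (T : ℝ) ^ (-κ) * Q) :=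
          mul_le_mul_of_nonneg_left (add_le_add (hD T hT1) h3) (by positivity)
      _ = (D + c * Q) * (T : ℝ) ^ (a + -κ) := by rw [Real.rpow_add hT0]; ring
      _ ≤ _ := mul_le_mul_of_nonneg_left
          (Real.rpow_le_rpow_of_exponent_le hT1' (by rw [hr]; linarith)) (by positivity)
  have hsum : ∀ n, ∑ s ∈ Finset.range n, ∫ ω, E s ω ∂P ≤ G * (2 / r * (T : ℝ) ^ (-r)) :=
    fun n => by
      refine (Finset.sum_le_sum fun s _ => hEint s).trans ?_
      rw [← Finset.mul_sum]
      exact mul_le_mul_of_nonneg_left (sum_rpow_neg_le (hge 0) hr0 hr1 n) hG0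
  have hmain := measure_exists_ge_le_of_le_add (P := P) (ℱ := 𝒢) (U := U) (m := N) (g := E)
    (((h.meas_V T).add ((h.meas_q T).const_mul _)).const_mul _)
    (fun s => (h.meas_m (T + s)).const_mul _)
    (fun s => by
      have h1 : ℱ (T + s) ≤ ℱ (T + s + 1) := ℱ.mono (Nat.le_succ _)
      exact (((((h.meas_y (T + s)).mono h1).const_mul _).const_mul _).add
        (((((h.meas_q (T + s)).mono h1).add (h.meas_q (T + s + 1))).const_mul _).const_mul
          _)).const_mul _)
    hUi (fun s => (h.int_m _).const_mul _)
    (fun s => ((hi1 s).add ((hqi s).const_mul _)).const_mul _) hU0 hE0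
    (fun s A hA => by
      simp only [N]
      rw [integral_const_mul, h.martingale (T + s) A hA, mul_zero])
    hstep (half_pos hε) hsum
  refine (measure_mono ?_).trans (hmain.trans (ENNReal.ofReal_le_ofReal ?_))
  · rintro ω ⟨t, htT, ht⟩
    obtain ⟨s, rfl⟩ := Nat.exists_eq_add_of_le htT
    exact ⟨s, by linarith [hUx s ω]⟩
  · rw [div_le_iff₀ (half_pos hε)]
    refine (add_le_add_left hEU _).trans_eq ?_
    field_simp

end LyapunovRecursion

section Drift

variable {dW : ℕ} {Ω : Type*} [MeasurableSpace Ω] {K : Kernel (Wsp dW) (Wsp dW)}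
  [IsMarkovKernel K] {ν : Measure (Wsp dW)} [IsProbabilityMeasure ν] {c₁ ρ : ℝ}
  {P : Measure Ω} [IsProbabilityMeasure P] {Wp : ℕ → Ω → Wsp dW} {w : Wsp dW}

/-- Replacing Markovian noise by a martingale increment through the Poisson equation: an iterate
`θ` with a drift inequality satisfies a `LyapunovRecursion`. -/
theorem IsMarkovProc.exists_lyapunovRecursion (hMP : IsMarkovProc K P Wp w)
    (hc₁ : 0 < c₁) (hρ₀ : 0 ≤ ρ) (hρ₁ : ρ < 1) (hU1 : UdBound K ν c₁ ρ 1)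
    (hq : ∀ t, Integrable (fun ω => (1 + ‖Wp t ω‖) ^ 2) P)
    {Θ : Type*} [MeasurableSpace Θ] {θ : ℕ → Ω → Θ}
    (hθ : ∀ t, Measurable[hMP.filtration t] (θ t)) {r : Θ → ℝ} (hr : Measurable r)
    (hr0 : ∀ p, 0 ≤ r p) {R : ℝ} (hrR : ∀ t ω, r (θ t ω) ≤ R) {g : Wsp dW → Θ → ℝ}
    (hg : Measurable fun p : Wsp dW × Θ => g p.1 p.2) {L : ℝ} (hL : 0 ≤ L)
    (hgr : ∀ p w', |g w' p| ≤ r p * L * (1 + ‖w'‖)) {κ α₀ ζ c₀ L' : ℝ} (hκ0 : 0 < κ)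
    (hκ1 : κ ≤ 1) (hα₀ : 0 < α₀) (hζ : 0 < ζ) (hc₀ : 0 ≤ c₀) (hL' : 0 ≤ L')
    (hlip : ∀ t : ℕ, 1 ≤ t → ∀ ω w', |g w' (θ (t + 1) ω) - g w' (θ t ω)| ≤
      L' * (t : ℝ) ^ (-κ) * (1 + ‖Wp t ω‖) * (1 + ‖w'‖))
    (hstep : ∀ t : ℕ, 1 ≤ t → ∀ ω, r (θ (t + 1) ω) ^ 2 ≤ r (θ t ω) ^ 2 +
      2 * (α₀ * (t : ℝ) ^ (-κ)) * g (Wp t ω) (θ t ω) +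
      (α₀ * (t : ℝ) ^ (-κ)) ^ 2 * L ^ 2 * (1 + ‖Wp t ω‖) ^ 2)
    {y : ℕ → Ω → ℝ} (hy : ∀ t, StronglyMeasurable[hMP.filtration t] (y t))
    (hyi : ∀ t, Integrable (y t) P) (hy0 : ∀ t ω, 0 ≤ y t ω)
    (hdrift : ∀ t ω, 2 * ∫ w', g w' (θ t ω) ∂ν ≤ -ζ * r (θ t ω) ^ 2 + c₀ * y t ω) :
    ∃ c : ℝ, 0 ≤ c ∧ ∃ V m : ℕ → Ω → ℝ,
      LyapunovRecursion P hMP.filtration κ (ζ * α₀) c (fun t ω => r (θ t ω) ^ 2) V y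
        (fun t ω => (1 + ‖Wp t ω‖) ^ 2) m := by
  set C₁ : ℝ := c₁ / (1 - ρ) with hC₁
  have hC₁0 : 0 ≤ C₁ := div_nonneg hc₁.le (by linarith)
  have hle : ∀ t, hMP.filtration t ≤ (inferInstance : MeasurableSpace Ω) := hMP.filtration.le
  have hR0 : 0 ≤ R := by
    obtain ⟨ω⟩ := P.nonempty_of_neZero
    exact (hr0 _).trans (hrR 0 ω)
  let h : Wsp dW → Θ → ℝ := fun w' p => poissonSol K ν (fun x => g x p) w'
  let gbar : Θ → ℝ := fun p => ∫ w', g w' p ∂ν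
  let n : Wsp dW → Θ → ℝ := fun w' p => h w' p - (g w' p - gbar p)
  have hgp : ∀ p, Measurable fun w' => g w' p := fun p =>
    hg.comp (measurable_id.prodMk measurable_const)
  have hhm : Measurable fun p : Wsp dW × Θ => h p.1 p.2 := measurable_poissonSol hg
  have hgbm : Measurable gbar :=
    (StronglyMeasurable.integral_prod_left' (μ := ν) hg.stronglyMeasurable).measurable
  have hnm : Measurable fun p : Wsp dW × Θ => n p.1 p.2 :=
    hhm.sub (hg.sub (hgbm.comp measurable_snd))
  have hrL : ∀ p, 0 ≤ r p * L := fun p => mul_nonneg (hr0 p) hL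
  have hh : ∀ w' p, |h w' p| ≤ r p * L * C₁ * (1 + ‖w'‖) := fun w' p =>
    hU1.abs_poissonSol_le hρ₀ hρ₁ (hgp p) (hrL p) (hgr p) w'
  have hn : ∀ w' p, ∫ x, h x p ∂(K w') = n w' p := fun w' p =>
    hU1.integral_poissonSol hρ₀ hρ₁ (hgp p) (hrL p) (hgr p) w'
  have hi1 : Integrable (fun x : Wsp dW => 1 + ‖x‖) ν := by
    simpa only [Real.rpow_one] using hU1.1
  have hgb : ∀ p, |gbar p| ≤ r p * L * ∫ x, (1 + ‖x‖) ∂ν := fun p => by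
    rw [← integral_const_mul]
    change ‖∫ w', g w' p ∂ν‖ ≤ _
    exact norm_integral_le_of_norm_le (hi1.const_mul _) (ae_of_all _ (hgr p))
  have hs : ∀ t ω, 1 + ‖Wp t ω‖ ≤ (1 + ‖Wp t ω‖) ^ 2 := fun t ω => by
    nlinarith [norm_nonneg (Wp t ω)]
  have hRL : ∀ t ω, r (θ t ω) * L ≤ R * L := fun t ω => mul_le_mul_of_nonneg_right (hrR t ω) hL
  have hθm : ∀ t, Measurable (θ t) := fun t => (hθ t).mono (hle t) le_rfl
  have hpair : ∀ t, Measurable[hMP.filtration t] fun ω => (Wp t ω, θ t ω) := fun t =>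
    (hMP.measurable_filtration le_rfl).prodMk (hθ t)
  have hhb : ∀ s t ω, |h (Wp s ω) (θ t ω)| ≤ R * L * C₁ * (1 + ‖Wp s ω‖) ^ 2 := fun s t ω =>
    (hh _ _).trans (mul_le_mul (mul_le_mul_of_nonneg_right (hRL t ω) hC₁0) (hs s ω)
      (by positivity) (by positivity))
  have hhi : ∀ s t, Integrable (fun ω => h (Wp s ω) (θ t ω)) P := fun s t =>
    ((hq s).const_mul (R * L * C₁)).mono'
      (hhm.comp ((hMP.meas s).prodMk (hθm t))).aestronglyMeasurable (ae_of_all _ (hhb s t))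
  have hgi : ∀ t, Integrable (fun ω => g (Wp t ω) (θ t ω)) P := fun t =>
    ((hq t).const_mul (R * L)).mono'
      (hg.comp ((hMP.meas t).prodMk (hθm t))).aestronglyMeasurable
      (ae_of_all _ fun ω => (hgr _ _).trans (mul_le_mul (hRL t ω) (hs t ω) (by positivity)
        (by positivity)))
  have hgbi : ∀ t, Integrable (fun ω => gbar (θ t ω)) P := fun t =>
    (integrable_const (R * L * ∫ x, (1 + ‖x‖) ∂ν)).mono'
      (hgbm.comp (hθm t)).aestronglyMeasurable
      (ae_of_all _ fun ω => (hgb _).trans (mul_le_mul_of_nonneg_right (hRL t ω)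
        (integral_nonneg fun x => by positivity)))
  have hni : ∀ t, Integrable (fun ω => n (Wp t ω) (θ t ω)) P := fun t =>
    (hhi t t).sub ((hgi t).sub (hgbi t))
  have hxi : ∀ t, Integrable (fun ω => r (θ t ω) ^ 2) P := fun t =>
    (integrable_const (R ^ 2)).mono' ((hr.comp (hθm t)).pow_const 2).aestronglyMeasurable
      (ae_of_all _ fun ω => by
        rw [Real.norm_of_nonneg (sq_nonneg _)]
        exact pow_le_pow_left₀ (hr0 _) (hrR t ω) 2)
  let α : ℕ → ℝ := fun t => α₀ * (t : ℝ) ^ (-κ)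
  set A : ℝ := L * C₁ with hA
  have hA0 : 0 ≤ A := by positivity
  refine ⟨2 * α₀ ^ 2 * A ^ 2 + α₀ * c₀ + α₀ * L' * C₁ + 2 * α₀ * (R * A) +
      2 * ζ * α₀ ^ 2 * (R * A) + α₀ ^ 2 * L ^ 2, by positivity,
    fun t ω => r (θ t ω) ^ 2 + 2 * α t * h (Wp t ω) (θ t ω),
    fun t ω => 2 * α t * (h (Wp (t + 1) ω) (θ t ω) - n (Wp t ω) (θ t ω)), ?_⟩
  refine
    { meas_V := fun t => ?_
      meas_y := hy
      meas_q := fun t => ?_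
      meas_m := fun t => ?_
      int_x := hxi
      int_V := fun t => (hxi t).add ((hhi t t).const_mul _)
      int_y := hyi
      int_q := hq
      int_m := fun t => ((hhi (t + 1) t).sub (hni t)).const_mul _
      x_nonneg := fun t ω => sq_nonneg _
      y_nonneg := hy0
      q_nonneg := fun t ω => sq_nonneg _
      martingale := fun t S hS => ?_
      lower := fun t ht ω => ?_
      step := fun t ht ω => ?_ }
  · exact (((hr.comp (hθ t)).pow_const 2).add
      ((hhm.comp (hpair t)).const_mul _)).stronglyMeasurable
  · have h1 : Measurable fun w' : Wsp dW => (1 + ‖w'‖) ^ 2 := by fun_prop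
    exact (h1.comp (hMP.measurable_filtration le_rfl)).stronglyMeasurable
  · have hmono := hMP.filtration.mono (Nat.le_succ t)
    exact (((hhm.comp ((hMP.measurable_filtration le_rfl).prodMk ((hθ t).mono hmono le_rfl))).sub
      (hnm.comp ((hpair t).mono hmono le_rfl))).const_mul _).stronglyMeasurable
  · rw [integral_const_mul, integral_sub (hhi (t + 1) t).integrableOn (hni t).integrableOn,
      hMP.setIntegral_succ t hS (hθ t) hhm (hhi (t + 1) t)]
    simp only [hn, sub_self, mul_zero]
  · have ht0 : (0 : ℝ) < t := by exact_mod_cast ht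
    have h1 := (abs_le.1 (hh (Wp t ω) (θ t ω))).1
    have h2 := hr0 (θ t ω)
    simp only [α]
    rw [rpow_neg_two_mul ht0]
    generalize h (Wp t ω) (θ t ω) = u at *
    generalize r (θ t ω) = x at *
    have hs0 : 0 ≤ 1 + ‖Wp t ω‖ := by positivity
    generalize 1 + ‖Wp t ω‖ = s at *
    have hτ : 0 < (t : ℝ) ^ (-κ) := by positivity
    generalize (t : ℝ) ^ (-κ) = τ at *
    have h3 := mul_le_mul_of_nonneg_left h1 (show 0 ≤ 2 * (α₀ * τ) by positivity)
    have h4 : 0 ≤ (α₀ * c₀ + α₀ * L' * C₁ + 2 * α₀ * (R * A) +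
      2 * ζ * α₀ ^ 2 * (R * A) + α₀ ^ 2 * L ^ 2) * (τ * τ) * s ^ 2 := by positivity
    have h5 := sq_nonneg (x - 2 * (α₀ * τ) * A * s)
    nlinarith
  · have ht0 : (0 : ℝ) < t := by exact_mod_cast ht
    have ht1 : (1 : ℝ) ≤ t := by exact_mod_cast ht
    have h1 := hstep t ht ω
    have h2 := hhb t t ω
    have h3 := hhb (t + 1) (t + 1) ω
    have h4 : |h (Wp (t + 1) ω) (θ (t + 1) ω) - h (Wp (t + 1) ω) (θ t ω)| ≤
        L' * (t : ℝ) ^ (-κ) * (1 + ‖Wp t ω‖) * C₁ * (1 + ‖Wp (t + 1) ω‖) := by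
      simp only [h]
      rw [← hU1.poissonSol_sub hρ₀ hρ₁ (hgp _) (hgp _) (hrL _) (hrL _) (hgr _) (hgr _)]
      exact hU1.abs_poissonSol_le hρ₀ hρ₁ ((hgp _).sub (hgp _)) (by positivity)
        (hlip t ht ω) _
    have h5 : gbar (θ t ω) * 2 ≤ _ := (mul_comm _ _).trans_le (hdrift t ω)
    have h6 := rpow_neg_mul_one_sub_inv_le ht1 hκ1
    have h7 : ((t + 1 : ℕ) : ℝ) ^ (-κ) ≤ (t : ℝ) ^ (-κ) :=
      Real.rpow_le_rpow_of_nonpos ht0 (by push_cast; linarith) (by linarith)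
    have h8 : 1 / (t : ℝ) ≤ (t : ℝ) ^ (-κ) := by
      rw [one_div, ← Real.rpow_neg_one]
      exact Real.rpow_le_rpow_of_exponent_le ht1 (by linarith)
    have hτ : 0 < (t : ℝ) ^ (-κ) := by positivity
    have h9 := hy0 t ω
    simp only [α, n]
    rw [rpow_neg_two_mul ht0]
    push_cast at h7 ⊢
    generalize hs' : 1 + ‖Wp t ω‖ = s at *
    generalize 1 + ‖Wp (t + 1) ω‖ = s' at *
    generalize h (Wp t ω) (θ t ω) = u at *
    generalize h (Wp (t + 1) ω) (θ t ω) = v at *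
    generalize h (Wp (t + 1) ω) (θ (t + 1) ω) = u' at *
    generalize g (Wp t ω) (θ t ω) = γ at *
    generalize gbar (θ t ω) = b at *
    generalize r (θ t ω) ^ 2 = x at *
    generalize r (θ (t + 1) ω) ^ 2 = x' at *
    generalize ((t : ℝ) + 1) ^ (-κ) = τ' at *
    generalize (t : ℝ) ^ (-κ) = τ at *
    generalize y t ω = Y at *
    have hs0 : 0 ≤ s ^ 2 := sq_nonneg s
    have hs0' : 0 ≤ s' ^ 2 := sq_nonneg s'
    have hRA : R * L * C₁ = R * A := mul_assoc _ _ _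
    rw [hRA] at h2 h3
    have e1 : 2 * (α₀ * τ) * (u' - v) ≤ α₀ * L' * C₁ * (τ * τ * (s ^ 2 + s' ^ 2)) := by
      have := mul_le_mul_of_nonneg_left ((le_abs_self _).trans h4)
        (show 0 ≤ 2 * (α₀ * τ) by positivity)
      have := mul_nonneg (show 0 ≤ α₀ * L' * C₁ * (τ * τ) by positivity) (sq_nonneg (s - s'))
      linarith
    have e2 : 2 * (α₀ * τ) * b ≤ α₀ * τ * (-ζ * x + c₀ * Y) := by
      have := mul_le_mul_of_nonneg_left h5 (show 0 ≤ α₀ * τ by positivity)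
      linarith
    have e3 : 2 * α₀ * (τ' - τ) * u' ≤ 2 * α₀ * (R * A) * (τ * τ * s' ^ 2) := by
      have hττ : τ - τ' ≤ τ * τ := by
        have := mul_le_mul_of_nonneg_left h8 hτ.le
        linarith
      have hu := mul_le_mul_of_nonneg_left ((neg_le_abs u').trans h3) (sub_nonneg.2 h7)
      have := mul_le_mul_of_nonneg_left (hu.trans (mul_le_mul_of_nonneg_right hττ
        (show 0 ≤ R * A * s' ^ 2 by positivity))) (show 0 ≤ 2 * α₀ by positivity)
      linarith
    have e4 : 2 * ζ * α₀ ^ 2 * (τ * τ) * u ≤ 2 * ζ * α₀ ^ 2 * (R * A) * (τ * τ * s ^ 2) := by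
      have := mul_le_mul_of_nonneg_left ((le_abs_self u).trans h2)
        (show 0 ≤ 2 * ζ * α₀ ^ 2 * (τ * τ) by positivity)
      linarith
    have p1 : 0 ≤ (2 * α₀ ^ 2 * A ^ 2 + α₀ * L' * C₁ + 2 * α₀ * (R * A) +
      2 * ζ * α₀ ^ 2 * (R * A) + α₀ ^ 2 * L ^ 2) * (τ * Y) := by positivity
    have p2 : 0 ≤ (2 * α₀ ^ 2 * A ^ 2 + α₀ * c₀) * (τ * τ * (s ^ 2 + s' ^ 2)) := by positivity
    have p3 : 0 ≤ 2 * α₀ * (R * A) * (τ * τ * s ^ 2) := by positivity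
    have p4 : 0 ≤ (2 * ζ * α₀ ^ 2 * (R * A) + α₀ ^ 2 * L ^ 2) * (τ * τ * s' ^ 2) := by
      positivity
    linarith

end Drift

section Projection

variable {E : Type*} [NormedAddCommGroup E] [InnerProductSpace ℝ E] {B : ℝ}

theorem norm_projB_le (hB : 0 ≤ B) (x : E) : ‖projB B x‖ ≤ B := by
  unfold projB
  split_ifs with h
  · exact h
  · have hx : 0 < ‖x‖ := hB.trans_lt (not_le.1 h)
    rw [norm_smul, Real.norm_of_nonneg (by positivity), div_mul_cancel₀ _ hx.ne']

theorem norm_projB_sub_le {p : E} (hp : ‖p‖ ≤ B) (x : E) : ‖projB B x - p‖ ≤ ‖x - p‖ := by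
  unfold projB
  split_ifs with h
  · exact le_rfl
  · have hB : 0 ≤ B := (norm_nonneg p).trans hp
    have hx : 0 < ‖x‖ := hB.trans_lt (not_le.1 h)
    set r := B / ‖x‖ with hr
    have hr0 : 0 ≤ r := by positivity
    have hr1 : r ≤ 1 := (div_le_one hx).2 (not_le.1 h).le
    have hrx : r * ‖x‖ = B := div_mul_cancel₀ _ hx.ne'
    refine le_of_sq_le_sq ?_ (norm_nonneg _)
    rw [norm_sub_sq_real, norm_sub_sq_real, norm_smul, Real.norm_of_nonneg hr0,
      real_inner_smul_left]
    have h1 : ⟪x, p⟫ ≤ ‖x‖ * (r * ‖x‖) := by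
      rw [hrx]
      exact (real_inner_le_norm x p).trans (mul_le_mul_of_nonneg_left hp hx.le)
    have h2 := mul_le_mul_of_nonneg_left h1 (sub_nonneg.2 hr1)
    have h3 : 0 ≤ ((1 - r) * ‖x‖) ^ 2 := sq_nonneg _
    nlinarith

theorem measurable_projB [MeasurableSpace E] [BorelSpace E] [SecondCountableTopology E] :
    Measurable (projB B : E → E) :=
  Measurable.ite (measurableSet_le measurable_norm measurable_const) measurable_id
    ((measurable_const.div measurable_norm).smul measurable_id)

end Projection

section Chain

variable {dW dL dX : ℕ} {Ω : Type*} [MeasurableSpace Ω] {K : Kernel (Wsp dW) (Wsp dW)}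
  [IsMarkovKernel K] {ν : Measure (Wsp dW)} [IsProbabilityMeasure ν] {c₁ ρ : ℝ}
  {P : Measure Ω} [IsProbabilityMeasure P] {Wp : ℕ → Ω → Wsp dW} {w : Wsp dW}

theorem IsMarkovProc.exists_lyapunovRecursion_projB (hMP : IsMarkovProc K P Wp w)
    (hc₁ : 0 < c₁) (hρ₀ : 0 ≤ ρ) (hρ₁ : ρ < 1) (hU1 : UdBound K ν c₁ ρ 1)
    (hq : ∀ t, Integrable (fun ω => (1 + ‖Wp t ω‖) ^ 2) P)
    {G : Wsp dW → EuclideanSpace ℝ (Fin dL) → EuclideanSpace ℝ (Fin dX) →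
      EuclideanSpace ℝ (Fin dL)}
    (hG : Measurable fun p : Wsp dW × EuclideanSpace ℝ (Fin dL) × EuclideanSpace ℝ (Fin dX) =>
      G p.1 p.2.1 p.2.2)
    {B L κ α₀ β₀ ζ c₀ : ℝ} (hL : 0 ≤ L)
    (hGlip : ∀ (w' : Wsp dW) a a' b b', ‖a‖ ≤ B → ‖a'‖ ≤ B → ‖b‖ ≤ B → ‖b'‖ ≤ B →
      ‖G w' a b - G w' a' b'‖ ≤ L * (1 + ‖w'‖) * (‖a - a'‖ + ‖b - b'‖))
    (hGgrow : ∀ (w' : Wsp dW) a b, ‖a‖ ≤ B → ‖b‖ ≤ B → ‖G w' a b‖ ≤ L * (1 + ‖w'‖))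
    (hκ0 : 0 < κ) (hκ1 : κ ≤ 1) (hα₀ : 0 < α₀) (hβ₀ : 0 ≤ β₀) (hζ : 0 < ζ) (hc₀ : 0 ≤ c₀)
    {p : EuclideanSpace ℝ (Fin dL)} {p' : EuclideanSpace ℝ (Fin dX)} (hp : ‖p‖ ≤ B)
    {u : ℕ → Ω → EuclideanSpace ℝ (Fin dL)} {v : ℕ → Ω → EuclideanSpace ℝ (Fin dX)}
    (hum : ∀ t, Measurable[hMP.filtration t] (u t))
    (hvm : ∀ t, Measurable[hMP.filtration t] (v t))
    (huB : ∀ t ω, ‖u t ω‖ ≤ B) (hvB : ∀ t ω, ‖v t ω‖ ≤ B)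
    (hu : ∀ t ω, u (t + 1) ω =
      projB B (u t ω + (α₀ * (t : ℝ) ^ (-κ)) • G (Wp t ω) (u t ω) (v t ω)))
    (hv : ∀ t : ℕ, 1 ≤ t → ∀ ω, ‖v (t + 1) ω - v t ω‖ ≤
      β₀ * (t : ℝ) ^ (-κ) * (L * (1 + ‖Wp t ω‖)))
    (hdrift : ∀ a b, ‖a‖ ≤ B → ‖b‖ ≤ B →
      2 * ∫ w', ⟪a - p, G w' a b⟫ ∂ν ≤ -ζ * ‖a - p‖ ^ 2 + c₀ * ‖b - p'‖ ^ 2) :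
    ∃ c : ℝ, 0 ≤ c ∧ ∃ V m : ℕ → Ω → ℝ,
      LyapunovRecursion P hMP.filtration κ (ζ * α₀) c (fun t ω => ‖u t ω - p‖ ^ 2) V
        (fun t ω => ‖v t ω - p'‖ ^ 2) (fun t ω => (1 + ‖Wp t ω‖) ^ 2) m := by
  have hB : 0 ≤ B := (norm_nonneg p).trans hp
  have hup : ∀ t ω, ‖u t ω - p‖ ≤ 2 * B := fun t ω =>
    (norm_sub_le _ _).trans (by linarith [huB t ω])
  have hvp : ∀ t ω, ‖v t ω - p'‖ ≤ B + ‖p'‖ := fun t ω =>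
    (norm_sub_le _ _).trans (by linarith [hvB t ω])
  let S : Set (EuclideanSpace ℝ (Fin dL) × EuclideanSpace ℝ (Fin dX)) :=
    {z | ‖z.1‖ ≤ B ∧ ‖z.2‖ ≤ B}
  have hS : MeasurableSet S :=
    (measurableSet_le measurable_fst.norm measurable_const).inter
      (measurableSet_le measurable_snd.norm measurable_const)
  have huv : ∀ t ω, (u t ω, v t ω) ∈ S := fun t ω => ⟨huB t ω, hvB t ω⟩
  let g : Wsp dW → EuclideanSpace ℝ (Fin dL) × EuclideanSpace ℝ (Fin dX) → ℝ := fun w' =>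
    S.indicator fun z => ⟪z.1 - p, G w' z.1 z.2⟫
  have hguv : ∀ w' t ω, g w' (u t ω, v t ω) = ⟪u t ω - p, G w' (u t ω) (v t ω)⟫ :=
    fun w' t ω => Set.indicator_of_mem (huv t ω) _
  have hg : Measurable fun z : Wsp dW × EuclideanSpace ℝ (Fin dL) × EuclideanSpace ℝ (Fin dX) =>
      g z.1 z.2 := by
    have h1 : Measurable fun z : Wsp dW × EuclideanSpace ℝ (Fin dL) ×
        EuclideanSpace ℝ (Fin dX) => ⟪z.2.1 - p, G z.1 z.2.1 z.2.2⟫ :=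
      (measurable_snd.fst.sub_const p).inner hG
    exact h1.indicator (measurable_snd hS)
  have hgr : ∀ (z : EuclideanSpace ℝ (Fin dL) × EuclideanSpace ℝ (Fin dX)) w',
      |g w' z| ≤ ‖z.1 - p‖ * L * (1 + ‖w'‖) := fun z w' => by
    by_cases hz : z ∈ S
    · simp only [g, Set.indicator_of_mem hz]
      rw [mul_assoc]
      exact (abs_real_inner_le_norm _ _).trans
        (mul_le_mul_of_nonneg_left (hGgrow w' _ _ hz.1 hz.2) (norm_nonneg _))
    · simp only [g, Set.indicator_of_notMem hz, abs_zero]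
      positivity
  have hdu : ∀ t : ℕ, 1 ≤ t → ∀ ω, ‖u (t + 1) ω - u t ω‖ ≤
      α₀ * (t : ℝ) ^ (-κ) * (L * (1 + ‖Wp t ω‖)) := fun t _ ω => by
    rw [hu]
    refine (norm_projB_sub_le (huB t ω) _).trans ?_
    rw [add_sub_cancel_left, norm_smul, Real.norm_of_nonneg (by positivity)]
    exact mul_le_mul_of_nonneg_left (hGgrow _ _ _ (huB t ω) (hvB t ω)) (by positivity)
  refine hMP.exists_lyapunovRecursion hc₁ hρ₀ hρ₁ hU1 hq (θ := fun t ω => (u t ω, v t ω))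
    (r := fun z => ‖z.1 - p‖) (fun t => (hum t).prodMk (hvm t))
    (measurable_fst.sub_const p).norm (fun _ => norm_nonneg _) hup hg hL hgr hκ0 hκ1 hα₀ hζ hc₀
    (L' := L * (α₀ * L) + 2 * B * L * (α₀ * L + β₀ * L)) (by positivity)
    (fun t ht ω w' => ?_) (fun t _ ω => ?_) (fun t => ?_) (fun t => ?_)
    (fun t ω => sq_nonneg _) (fun t ω => ?_)
  · have h1 := hdu t ht ω
    have h2 := hv t ht ω
    have h3 := hup t ω
    have hlip := hGlip w' _ _ _ _ (huB (t + 1) ω) (huB t ω) (hvB (t + 1) ω) (hvB t ω)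
    have hgrow := hGgrow w' _ _ (huB (t + 1) ω) (hvB (t + 1) ω)
    simp only [hguv]
    have e : ⟪u (t + 1) ω - p, G w' (u (t + 1) ω) (v (t + 1) ω)⟫ -
        ⟪u t ω - p, G w' (u t ω) (v t ω)⟫ =
        ⟪u (t + 1) ω - u t ω, G w' (u (t + 1) ω) (v (t + 1) ω)⟫ +
        ⟪u t ω - p, G w' (u (t + 1) ω) (v (t + 1) ω) - G w' (u t ω) (v t ω)⟫ := by
      simp only [inner_sub_left, inner_sub_right]
      ring
    rw [e]
    calc _ ≤ ‖u (t + 1) ω - u t ω‖ * ‖G w' (u (t + 1) ω) (v (t + 1) ω)‖ +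
          ‖u t ω - p‖ * ‖G w' (u (t + 1) ω) (v (t + 1) ω) - G w' (u t ω) (v t ω)‖ :=
          (abs_add_le _ _).trans
            (add_le_add (abs_real_inner_le_norm _ _) (abs_real_inner_le_norm _ _))
      _ ≤ (α₀ * (t : ℝ) ^ (-κ) * (L * (1 + ‖Wp t ω‖))) * (L * (1 + ‖w'‖)) +
          (2 * B) * (L * (1 + ‖w'‖) * (α₀ * (t : ℝ) ^ (-κ) * (L * (1 + ‖Wp t ω‖)) +
            β₀ * (t : ℝ) ^ (-κ) * (L * (1 + ‖Wp t ω‖)))) := by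
          refine add_le_add (mul_le_mul h1 hgrow (norm_nonneg _) (by positivity))
            (mul_le_mul h3 (hlip.trans ?_) (norm_nonneg _) (by positivity))
          exact mul_le_mul_of_nonneg_left (add_le_add h1 h2) (by positivity)
      _ = _ := by ring
  · rw [hguv]
    have h1 := norm_projB_sub_le hp (u t ω + (α₀ * (t : ℝ) ^ (-κ)) • G (Wp t ω) (u t ω) (v t ω))
    rw [← hu] at h1
    refine (pow_le_pow_left₀ (norm_nonneg _) h1 2).trans ?_
    rw [add_sub_right_comm, norm_add_sq_real, real_inner_smul_right, norm_smul,
      Real.norm_of_nonneg (by positivity), mul_pow]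
    have h2 := pow_le_pow_left₀ (norm_nonneg _) (hGgrow (Wp t ω) _ _ (huB t ω) (hvB t ω)) 2
    have h3 := mul_le_mul_of_nonneg_left h2 (sq_nonneg (α₀ * (t : ℝ) ^ (-κ)))
    linarith
  · have h1 : Measurable fun b : EuclideanSpace ℝ (Fin dX) => ‖b - p'‖ ^ 2 := by fun_prop
    exact (h1.comp (hvm t)).stronglyMeasurable
  · have h1 : Measurable fun b : EuclideanSpace ℝ (Fin dX) => ‖b - p'‖ ^ 2 := by fun_prop
    refine (integrable_const ((B + ‖p'‖) ^ 2)).mono'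
      (h1.comp ((hvm t).mono (hMP.filtration.le t) le_rfl)).aestronglyMeasurable
      (ae_of_all _ fun ω => ?_)
    rw [Real.norm_of_nonneg (sq_nonneg _)]
    exact pow_le_pow_left₀ (norm_nonneg _) (hvp t ω) 2
  · simp only [hguv]
    exact hdrift _ _ (huB t ω) (hvB t ω)

end Chain

section Iterates

variable {dW dL dX : ℕ} {Ω : Type*} {Wp : ℕ → Ω → Wsp dW}
  {G : Wsp dW → EuclideanSpace ℝ (Fin dL) → EuclideanSpace ℝ (Fin dX) →
    EuclideanSpace ℝ (Fin dL)}
  {H : Wsp dW → EuclideanSpace ℝ (Fin dX) → EuclideanSpace ℝ (Fin dX)}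
  {α β : ℕ → ℝ} {B : ℝ} {lam0 : EuclideanSpace ℝ (Fin dL)} {xi0 : EuclideanSpace ℝ (Fin dX)}

theorem xiSeq_succ (t : ℕ) (ω : Ω) : xiSeq H β B Wp xi0 (t + 1) ω =
    projB B (xiSeq H β B Wp xi0 t ω + β t • H (Wp t ω) (xiSeq H β B Wp xi0 t ω)) := rfl

theorem lamSeq_succ (t : ℕ) (ω : Ω) : lamSeq G H α β B Wp lam0 xi0 (t + 1) ω =
    projB B (lamSeq G H α β B Wp lam0 xi0 t ω +
      α t • G (Wp t ω) (lamSeq G H α β B Wp lam0 xi0 t ω) (xiSeq H β B Wp xi0 t ω)) := rfl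

theorem norm_xiSeq_le (hB : 0 ≤ B) (hxi0 : ‖xi0‖ ≤ B) (t : ℕ) (ω : Ω) :
    ‖xiSeq H β B Wp xi0 t ω‖ ≤ B := by
  cases t with
  | zero => exact hxi0
  | succ t => exact norm_projB_le hB _

theorem norm_lamSeq_le (hB : 0 ≤ B) (hlam0 : ‖lam0‖ ≤ B) (t : ℕ) (ω : Ω) :
    ‖lamSeq G H α β B Wp lam0 xi0 t ω‖ ≤ B := by
  cases t with
  | zero => exact hlam0
  | succ t => exact norm_projB_le hB _

variable [MeasurableSpace Ω] {K : Kernel (Wsp dW) (Wsp dW)} {P : Measure Ω} {w : Wsp dW}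

theorem IsMarkovProc.measurable_xiSeq (hMP : IsMarkovProc K P Wp w)
    (hH : Measurable fun p : Wsp dW × EuclideanSpace ℝ (Fin dX) => H p.1 p.2) (t : ℕ) :
    Measurable[hMP.filtration t] (xiSeq H β B Wp xi0 t) := by
  induction t with
  | zero => exact measurable_const
  | succ t ih =>
    have h : Measurable fun p : Wsp dW × EuclideanSpace ℝ (Fin dX) =>
        projB B (p.2 + β t • H p.1 p.2) :=
      measurable_projB.comp (measurable_snd.add (hH.const_smul (β t)))
    have hpair : Measurable[hMP.filtration (t + 1)] fun ω => (Wp t ω, xiSeq H β B Wp xi0 t ω) :=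
      (hMP.measurable_filtration (Nat.le_succ t)).prodMk
        (ih.mono (hMP.filtration.mono (Nat.le_succ t)) le_rfl)
    rw [funext (xiSeq_succ (H := H) (β := β) (B := B) (Wp := Wp) (xi0 := xi0) t)]
    exact (h.comp hpair :)

theorem IsMarkovProc.measurable_lamSeq (hMP : IsMarkovProc K P Wp w)
    (hG : Measurable fun p : Wsp dW × EuclideanSpace ℝ (Fin dL) × EuclideanSpace ℝ (Fin dX) =>
      G p.1 p.2.1 p.2.2)
    (hH : Measurable fun p : Wsp dW × EuclideanSpace ℝ (Fin dX) => H p.1 p.2) (t : ℕ) :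
    Measurable[hMP.filtration t] (lamSeq G H α β B Wp lam0 xi0 t) := by
  induction t with
  | zero => exact measurable_const
  | succ t ih =>
    have h : Measurable fun p : Wsp dW × EuclideanSpace ℝ (Fin dL) × EuclideanSpace ℝ (Fin dX) =>
        projB B (p.2.1 + α t • G p.1 p.2.1 p.2.2) :=
      measurable_projB.comp (measurable_snd.fst.add (hG.const_smul (α t)))
    have hmono := hMP.filtration.mono (Nat.le_succ t)
    have hpair : Measurable[hMP.filtration (t + 1)] fun ω =>
        (Wp t ω, lamSeq G H α β B Wp lam0 xi0 t ω, xiSeq H β B Wp xi0 t ω) :=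
      (hMP.measurable_filtration (Nat.le_succ t)).prodMk
        ((ih.mono hmono le_rfl).prodMk ((hMP.measurable_xiSeq hH t).mono hmono le_rfl))
    rw [funext (lamSeq_succ (G := G) (H := H) (α := α) (β := β) (B := B) (Wp := Wp)
      (lam0 := lam0) (xi0 := xi0) t)]
    exact (h.comp hpair :)

end Iterates

section Assumption

variable {dW dL dX : ℕ} {ν : Measure (Wsp dW)}
  {G : Wsp dW → EuclideanSpace ℝ (Fin dL) → EuclideanSpace ℝ (Fin dX) →
    EuclideanSpace ℝ (Fin dL)}
  {H : Wsp dW → EuclideanSpace ℝ (Fin dX) → EuclideanSpace ℝ (Fin dX)}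
  {lamStar : EuclideanSpace ℝ (Fin dL)} {xiStar : EuclideanSpace ℝ (Fin dX)} {B L ζ ψ : ℝ}

theorem Assumption2.norm_lamStar_le (h : Assumption2 ν G H lamStar xiStar B L ζ ψ) :
    ‖lamStar‖ ≤ B := (le_max_left _ _).trans h.hB.le

theorem Assumption2.norm_xiStar_le (h : Assumption2 ν G H lamStar xiStar B L ζ ψ) :
    ‖xiStar‖ ≤ B := (le_max_right _ _).trans h.hB.le

theorem Assumption2.integral_inner_H_le (h : Assumption2 ν G H lamStar xiStar B L ζ ψ)
    (hν : Integrable (fun x : Wsp dW => 1 + ‖x‖) ν) {b : EuclideanSpace ℝ (Fin dX)}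
    (hb : ‖b‖ ≤ B) : ∫ w', ⟪b - xiStar, H w' b⟫ ∂ν ≤ -ψ * ‖b - xiStar‖ ^ 2 := by
  have hint : Integrable (fun w' => H w' b) ν := (hν.const_mul L).mono'
    (h.hHmeas.comp (measurable_id.prodMk measurable_const)).aestronglyMeasurable
    (ae_of_all _ fun w' => h.hHgrow w' b hb)
  have h1 := h.hHmono b
  rwa [h.hHstar, sub_zero, ← integral_inner hint] at h1

theorem Assumption2.integral_inner_G_le (h : Assumption2 ν G H lamStar xiStar B L ζ ψ)
    (hν : Integrable (fun x : Wsp dW => 1 + ‖x‖) ν) {a : EuclideanSpace ℝ (Fin dL)}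
    {b : EuclideanSpace ℝ (Fin dX)} (ha : ‖a‖ ≤ B) (hb : ‖b‖ ≤ B) :
    ∫ w', ⟪a - lamStar, G w' a b⟫ ∂ν ≤ -ζ * ‖a - lamStar‖ ^ 2 +
      ‖a - lamStar‖ * (L * (∫ x, (1 + ‖x‖) ∂ν) * ‖b - xiStar‖) := by
  have hint : ∀ b', ‖b'‖ ≤ B → Integrable (fun w' => G w' a b') ν := fun b' hb' =>
    (hν.const_mul L).mono'
      (h.hGmeas.comp (measurable_id.prodMk (measurable_const (a := (a, b'))))).aestronglyMeasurable
      (ae_of_all _ fun w' => h.hGgrow w' a b' ha hb')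
  have hξ := h.norm_xiStar_le
  have h1 := h.hGmono a
  rw [h.hGstar, sub_zero] at h1
  have h2 : ‖(∫ w', G w' a b ∂ν) - ∫ w', G w' a xiStar ∂ν‖ ≤
      L * (∫ x, (1 + ‖x‖) ∂ν) * ‖b - xiStar‖ := by
    rw [← integral_sub (hint b hb) (hint xiStar hξ), ← integral_const_mul,
      ← integral_mul_const]
    refine norm_integral_le_of_norm_le ((hν.const_mul L).mul_const _) (ae_of_all _ fun w' => ?_)
    simpa using h.hGLip w' a a b xiStar ha ha hb hξ
  have h3 := (real_inner_le_norm (a - lamStar)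
    ((∫ w', G w' a b ∂ν) - ∫ w', G w' a xiStar ∂ν)).trans
    (mul_le_mul_of_nonneg_left h2 (norm_nonneg _))
  rw [inner_sub_right] at h3
  rw [integral_inner (hint b hb)]
  linarith

end Assumption

section TailBound

variable {dW dL dX : ℕ} {Ω : Type*} [MeasurableSpace Ω] {K : Kernel (Wsp dW) (Wsp dW)}
  [IsMarkovKernel K] {ν : Measure (Wsp dW)} [IsProbabilityMeasure ν] {c₁ ρ : ℝ}
  {P : Measure Ω} [IsProbabilityMeasure P] {Wp : ℕ → Ω → Wsp dW} {w : Wsp dW}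
  {G : Wsp dW → EuclideanSpace ℝ (Fin dL) → EuclideanSpace ℝ (Fin dX) →
    EuclideanSpace ℝ (Fin dL)}
  {H : Wsp dW → EuclideanSpace ℝ (Fin dX) → EuclideanSpace ℝ (Fin dX)}
  {lamStar : EuclideanSpace ℝ (Fin dL)} {xiStar : EuclideanSpace ℝ (Fin dX)} {B L ζ ψ : ℝ}
  {α₀ β₀ κ δ : ℝ} {lam0 : EuclideanSpace ℝ (Fin dL)} {xi0 : EuclideanSpace ℝ (Fin dX)}

/-- Mean-square convergence rate of the slow iterate. -/
theorem Assumption2.exists_integral_norm_sq_xiSeq_le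
    (hA2 : Assumption2 ν G H lamStar xiStar B L ζ ψ) (hMP : IsMarkovProc K P Wp w)
    (hc₁ : 0 < c₁) (hρ₀ : 0 ≤ ρ) (hρ₁ : ρ < 1) (hU1 : UdBound K ν c₁ ρ 1)
    (hU2 : UdBound K ν c₁ ρ 2) (hβ₀ : 0 < β₀) (hδ0 : 0 < δ) (hδ1 : δ < 1)
    (hxi0 : ‖xi0‖ ≤ B) :
    ∃ D : ℝ, 0 ≤ D ∧ ∀ t : ℕ, 1 ≤ t →
      ∫ ω, ‖xiSeq H (fun s => β₀ * (s : ℝ) ^ (-δ)) B Wp xi0 t ω - xiStar‖ ^ 2 ∂P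
        ≤ D * (t : ℝ) ^ (-δ) := by
  obtain ⟨hq, Q, hQ0, hQ⟩ := hMP.second_moment hc₁.le hρ₀ hρ₁.le hU2
  have hν : Integrable (fun x : Wsp dW => 1 + ‖x‖) ν := by
    simpa only [Real.rpow_one] using hU1.1
  have hB : 0 ≤ B := (norm_nonneg xi0).trans hxi0
  have hL := hA2.hL
  have hψ := hA2.hψ
  obtain ⟨c, hc, V, m, hrec⟩ := hMP.exists_lyapunovRecursion_projB (ν := ν)
    (G := fun w' a (_ : EuclideanSpace ℝ (Fin 0)) => H w' a) (p := xiStar) (p' := 0)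
    (u := xiSeq H (fun s => β₀ * (s : ℝ) ^ (-δ)) B Wp xi0) (v := fun _ _ => 0)
    (ζ := 2 * ψ) (c₀ := 0) (β₀ := 0) hc₁ hρ₀ hρ₁ hU1 hq
    (hA2.hHmeas.comp (measurable_fst.prodMk measurable_snd.fst)) hL.le
    (fun w' a a' b b' ha ha' _ _ => (hA2.hHLip w' a a' ha ha').trans
      (mul_le_mul_of_nonneg_left (le_add_of_nonneg_right (norm_nonneg _)) (by positivity)))
    (fun w' a _ ha _ => hA2.hHgrow w' a ha) hδ0 hδ1.le hβ₀ le_rfl (by positivity) le_rfl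
    hA2.norm_xiStar_le (hMP.measurable_xiSeq hA2.hHmeas) (fun _ => measurable_const)
    (norm_xiSeq_le hB hxi0) (fun _ _ => by simpa using hB) (fun _ _ => rfl)
    (fun _ _ _ => by simp) (fun a _ ha _ => by linarith [hA2.integral_inner_H_le hν ha])
  exact hrec.exists_integral_x_le hδ0 hδ1 (by positivity) hc hQ hQ0
    (Y := 0) (fun t _ => by simp) le_rfl

/-- Trajectory tail bound for the fast iterate. -/
theorem Assumption2.exists_measure_lamSeq_le
    (hA2 : Assumption2 ν G H lamStar xiStar B L ζ ψ) (hMP : IsMarkovProc K P Wp w)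
    (hc₁ : 0 < c₁) (hρ₀ : 0 ≤ ρ) (hρ₁ : ρ < 1) (hU1 : UdBound K ν c₁ ρ 1)
    (hU2 : UdBound K ν c₁ ρ 2) (hα₀ : 0 < α₀) (hβ₀ : 0 < β₀) (hκ0 : 0 < κ) (hκδ : κ ≤ δ)
    (hδ1 : δ < 1) (hlam0 : ‖lam0‖ ≤ B) (hxi0 : ‖xi0‖ ≤ B) {a ε : ℝ} (ha : a < 2 * κ - 1)
    (ha0 : 0 ≤ a) (hε : 0 < ε) :
    ∃ M : ℝ, 0 ≤ M ∧ ∃ T₀ : ℕ, ∀ T : ℕ, T₀ ≤ T →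
      P {ω | ∃ t : ℕ, T ≤ t ∧ ε ≤ (t : ℝ) ^ a * ‖lamSeq G H (fun s => α₀ * (s : ℝ) ^ (-κ))
        (fun s => β₀ * (s : ℝ) ^ (-δ)) B Wp lam0 xi0 t ω - lamStar‖ ^ 2}
        ≤ ENNReal.ofReal (M * (T : ℝ) ^ (-(2 * κ - 1 - a))) := by
  obtain ⟨hq, Q, hQ0, hQ⟩ := hMP.second_moment hc₁.le hρ₀ hρ₁.le hU2
  obtain ⟨Y, hY0, hY⟩ := hA2.exists_integral_norm_sq_xiSeq_le hMP hc₁ hρ₀ hρ₁ hU1 hU2 hβ₀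
    (hκ0.trans_le hκδ) hδ1 hxi0
  have hν : Integrable (fun x : Wsp dW => 1 + ‖x‖) ν := by
    simpa only [Real.rpow_one] using hU1.1
  have hB : 0 ≤ B := (norm_nonneg xi0).trans hxi0
  have hL := hA2.hL
  have hζ := hA2.hζ
  have hle : ∀ t : ℕ, 1 ≤ t → (t : ℝ) ^ (-δ) ≤ (t : ℝ) ^ (-κ) := fun t ht =>
    Real.rpow_le_rpow_of_exponent_le (by exact_mod_cast ht) (by linarith)
  have hxi := norm_xiSeq_le (H := H) (β := fun s => β₀ * (s : ℝ) ^ (-δ)) (Wp := Wp) hB hxi0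
  obtain ⟨c, hc, V, m, hrec⟩ := hMP.exists_lyapunovRecursion_projB (ν := ν)
    (p := lamStar) (p' := xiStar)
    (u := lamSeq G H (fun s => α₀ * (s : ℝ) ^ (-κ)) (fun s => β₀ * (s : ℝ) ^ (-δ)) B Wp lam0 xi0)
    (v := xiSeq H (fun s => β₀ * (s : ℝ) ^ (-δ)) B Wp xi0)
    (c₀ := (L * ∫ x, (1 + ‖x‖) ∂ν) ^ 2 / ζ) hc₁ hρ₀ hρ₁ hU1 hq hA2.hGmeas hL.le hA2.hGLip
    hA2.hGgrow hκ0 (hκδ.trans hδ1.le) hα₀ hβ₀.le hζ (by positivity) hA2.norm_lamStar_le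
    (hMP.measurable_lamSeq hA2.hGmeas hA2.hHmeas) (hMP.measurable_xiSeq hA2.hHmeas)
    (norm_lamSeq_le hB hlam0) hxi (fun _ _ => rfl)
    (fun t ht ω => by
      rw [xiSeq_succ]
      refine (norm_projB_sub_le (hxi t ω) _).trans ?_
      rw [add_sub_cancel_left, norm_smul, Real.norm_of_nonneg (by positivity)]
      exact mul_le_mul (mul_le_mul_of_nonneg_left (hle t ht) hβ₀.le)
        (hA2.hHgrow _ _ (hxi t ω)) (norm_nonneg _) (by positivity))
    (fun a' b' ha' hb' => by
      refine (mul_le_mul_of_nonneg_left (hA2.integral_inner_G_le hν ha' hb') zero_le_two).trans ?_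
      set μ := L * ∫ x, (1 + ‖x‖) ∂ν
      have h1 : 0 ≤ (ζ * ‖a' - lamStar‖ - μ * ‖b' - xiStar‖) ^ 2 / ζ := by positivity
      have h2 : (ζ * ‖a' - lamStar‖ - μ * ‖b' - xiStar‖) ^ 2 / ζ = ζ * ‖a' - lamStar‖ ^ 2 -
          2 * (‖a' - lamStar‖ * (μ * ‖b' - xiStar‖)) + μ ^ 2 / ζ * ‖b' - xiStar‖ ^ 2 := by
        field_simp
        ring
      linarith)
  exact hrec.exists_tail_bound hκ0 (hκδ.trans_lt hδ1) (by positivity) hc hQ hQ0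
    (fun t ht => (hY t ht).trans (mul_le_mul_of_nonneg_left (hle t ht) hY0)) hY0 ha ha0 hε

end TailBound

/-- Theorem 1(i): finite-time trajectory stability bound for the fast iterate. -/
theorem theorem1_i
    {dW dL dX : ℕ} {Ω : Type*} [MeasurableSpace Ω]
    (K : Kernel (Wsp dW) (Wsp dW)) [IsMarkovKernel K]
    (ν : Measure (Wsp dW)) [IsProbabilityMeasure ν]
    (hstat : ν.bind (⇑K) = ν)
    (c₁ ρ : ℝ) (hc₁ : 0 < c₁) (hρ₀ : 0 ≤ ρ) (hρ₁ : ρ < 1)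
    (hU1 : UdBound K ν c₁ ρ 1) (hU2 : UdBound K ν c₁ ρ 2)
    (G : Wsp dW → EuclideanSpace ℝ (Fin dL) → EuclideanSpace ℝ (Fin dX) →
      EuclideanSpace ℝ (Fin dL))
    (H : Wsp dW → EuclideanSpace ℝ (Fin dX) → EuclideanSpace ℝ (Fin dX))
    (lamStar : EuclideanSpace ℝ (Fin dL)) (xiStar : EuclideanSpace ℝ (Fin dX))
    (B L ζ ψ : ℝ)
    (hA2 : Assumption2 ν G H lamStar xiStar B L ζ ψ)
    (α₀ β₀ κ δ : ℝ) (hα₀ : 0 < α₀) (hβ₀ : 0 < β₀)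
    (hκlow : 1/2 < κ) (hκδ : κ ≤ δ) (hδhigh : δ < 1)
    (P : Measure Ω) [IsProbabilityMeasure P]
    (Wp : ℕ → Ω → Wsp dW) (w : Wsp dW)
    (hMP : IsMarkovProc K P Wp w)
    (lam0 : EuclideanSpace ℝ (Fin dL)) (xi0 : EuclideanSpace ℝ (Fin dX))
    (hlam0 : ‖lam0‖ ≤ B) (hxi0 : ‖xi0‖ ≤ B)
    (C κc δc : ℝ) (hC : 0 < C)
    (hκc0 : 0 ≤ κc) (hκc1 : κc < κ - 1/2)
    (hδc0 : 0 ≤ δc) (hδc1 : δc < δ - 1/2) :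
    (∃ Clam : ℝ, 0 < Clam ∧ ∃ T₀ : ℕ, ∀ T : ℕ, T₀ ≤ T →
        1 - Clam * (T : ℝ) ^ (-(2 * κ - 1 - 2 * κc)) * Real.log T
          ≤ (P {ω | ∀ t : ℕ, T ≤ t →
              ‖lamSeq G H (fun s => α₀ * (s : ℝ) ^ (-κ)) (fun s => β₀ * (s : ℝ) ^ (-δ))
                B Wp lam0 xi0 t ω - lamStar‖ ≤ C * (t : ℝ) ^ (-κc)}).toReal) ∧
    ((∀ w', K w' = ν) →
      ∃ Clam : ℝ, 0 < Clam ∧ ∃ T₀ : ℕ, ∀ T : ℕ, T₀ ≤ T →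
        1 - Clam * (T : ℝ) ^ (-(2 * κ - 1 - 2 * κc))
          ≤ (P {ω | ∀ t : ℕ, T ≤ t →
              ‖lamSeq G H (fun s => α₀ * (s : ℝ) ^ (-κ)) (fun s => β₀ * (s : ℝ) ^ (-δ))
                B Wp lam0 xi0 t ω - lamStar‖ ≤ C * (t : ℝ) ^ (-κc)}).toReal) := by
  have hκ0 : 0 < κ := by linarith
  obtain ⟨M, hM0, T₀, hT₀⟩ := hA2.exists_measure_lamSeq_le hMP hc₁ hρ₀ hρ₁ hU1 hU2 hα₀ hβ₀ hκ0
    hκδ hδhigh hlam0 hxi0 (a := 2 * κc) (ε := C ^ 2) (by linarith) (by linarith) (by positivity)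
  have hmain : ∀ T : ℕ, max T₀ 3 ≤ T →
      1 - (M + 1) * (T : ℝ) ^ (-(2 * κ - 1 - 2 * κc))
        ≤ (P {ω | ∀ t : ℕ, T ≤ t →
          ‖lamSeq G H (fun s => α₀ * (s : ℝ) ^ (-κ)) (fun s => β₀ * (s : ℝ) ^ (-δ))
            B Wp lam0 xi0 t ω - lamStar‖ ≤ C * (t : ℝ) ^ (-κc)}).toReal := by
    intro T hT
    set S : Set Ω := {ω | ∀ t : ℕ, T ≤ t →
      ‖lamSeq G H (fun s => α₀ * (s : ℝ) ^ (-κ)) (fun s => β₀ * (s : ℝ) ^ (-δ))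
        B Wp lam0 xi0 t ω - lamStar‖ ≤ C * (t : ℝ) ^ (-κc)} with hS
    have hT1 : 1 ≤ T := by have := le_of_max_le_right hT; omega
    have hpow : 0 ≤ (T : ℝ) ^ (-(2 * κ - 1 - 2 * κc)) := by positivity
    have hcompl : P Sᶜ ≤ ENNReal.ofReal (M * (T : ℝ) ^ (-(2 * κ - 1 - 2 * κc))) := by
      refine (measure_mono fun ω hω => ?_).trans (hT₀ T (le_of_max_le_left hT))
      simp only [hS, Set.mem_compl_iff, Set.mem_ofPred_eq, not_forall, not_le] at hω
      obtain ⟨t, ht, hlt⟩ := hω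
      have ht0 : (0 : ℝ) < t := by exact_mod_cast hT1.trans ht
      refine ⟨t, ht, ?_⟩
      have h1 := pow_le_pow_left₀ (by positivity) hlt.le 2
      have h2 : (t : ℝ) ^ (2 * κc) * (C * (t : ℝ) ^ (-κc)) ^ 2 = C ^ 2 := by
        rw [mul_pow, ← Real.rpow_natCast ((t : ℝ) ^ (-κc)) 2, ← Real.rpow_mul ht0.le,
          mul_left_comm, ← Real.rpow_add ht0]
        norm_num [mul_comm]
      rw [← h2]
      exact mul_le_mul_of_nonneg_left h1 (by positivity)
    have hone : (1 : ENNReal) ≤ P S + P Sᶜ := by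
      rw [← measure_univ (μ := P), ← Set.union_compl_self S]
      exact measure_union_le _ _
    have hle : (P Sᶜ).toReal ≤ M * (T : ℝ) ^ (-(2 * κ - 1 - 2 * κc)) :=
      ENNReal.toReal_le_of_le_ofReal (by positivity) hcompl
    have hone' := ENNReal.toReal_mono (by finiteness) hone
    rw [ENNReal.toReal_add (by finiteness) (by finiteness), ENNReal.toReal_one] at hone'
    linarith
  refine ⟨⟨M + 1, by positivity, max T₀ 3, fun T hT => le_trans ?_ (hmain T hT)⟩,
    fun _ => ⟨M + 1, by positivity, max T₀ 3, hmain⟩⟩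
  have hlog : 1 ≤ Real.log T := by
    have hT3 : (3 : ℝ) ≤ T := by exact_mod_cast le_of_max_le_right hT
    rw [Real.le_log_iff_exp_le (by linarith)]
    linarith [Real.exp_one_lt_d9]
  exact sub_le_sub_left (le_mul_of_one_le_right (by positivity) hlog) _

end
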